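/- arXiv:0806.2922 — 10 statements merged into one kernel-verified Lean document; each statement's English description precedes it below -/
import Mathlib

section
/- Fix an integer k ≥ 2. For every δ > 0 there exists L ∈ ℕ such that for all pairs (u,v) and (u',v') of sequences in (Fin k)^ℕ each satisfying the admissibility condition (∀n ≥ 0: u ≼ σⁿu ≼ v and u ≼ σⁿv ≼ v in the lexicographic order), if u and u' agree on their first L coordinates and v and v' agree on their first L coordinates, then |h_top(Σ_{u',v'}) − h_top(Σ_{u,v})| ≤ δ, where Σ_{u,v} := {x ∈ (Fin k)^ℕ : ∀n ≥ 0, u ≼ σⁿx ≼ v} and h_top denotes the topological entropy of the left shift restricted to this compact shift-invariant set. -/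
open Dynamics

/-- Give each `Fin k` the discrete uniformity, so that `(Fin k)^ℕ` carries the product
uniformity (inducing the product topology of the discrete topologies). -/
local instance (k : ℕ) : UniformSpace (Fin k) := ⊥

/-- The left shift on `(Fin k)^ℕ`. -/
def shiftF {k : ℕ} (x : ℕ → Fin k) : ℕ → Fin k := fun n => x (n + 1)

/-- Lexicographic order on `(Fin k)^ℕ`: `x ≼ y` iff `x = y` or `x_n < y_n` at the first
index `n` where they differ. -/
def LexLe {k : ℕ} (x y : ℕ → Fin k) : Prop :=
  x = y ∨ ∃ n : ℕ, (∀ m < n, x m = y m) ∧ x n < y n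

/-- Admissibility of the pair of critical orbits `(u,v)`:
`u ≼ σⁿu ≼ v` and `u ≼ σⁿv ≼ v` for all `n`. -/
def Admissible {k : ℕ} (u v : ℕ → Fin k) : Prop :=
  ∀ n : ℕ, LexLe u (shiftF^[n] u) ∧ LexLe (shiftF^[n] u) v ∧
    LexLe u (shiftF^[n] v) ∧ LexLe (shiftF^[n] v) v

/-- The shift space `Σ_{u,v} = {x : ∀ n, u ≼ σⁿx ≼ v}`. -/
def SigmaUV {k : ℕ} (u v : ℕ → Fin k) : Set (ℕ → Fin k) :=
  {x | ∀ n : ℕ, LexLe u (shiftF^[n] x) ∧ LexLe (shiftF^[n] x) v}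

section analytic
open Filter Topology

noncomputable def Gfun (d : ℕ → ℝ) (t : ℝ) : ℝ := (1 - t * ∑' j, d j * t ^ j) * (1 - t)

structure GoodSeq (k : ℕ) (d Z : ℕ → ℝ) (h : ℝ) : Prop where
  bd : ∀ j, |d j| ≤ k
  nn : ∀ n, 0 ≤ Z n
  z0 : Z 0 = 1
  ren : ∀ n, Z (n + 1) = 1 + ∑ j ∈ Finset.range (n + 1), d j * Z (n - j)
  h0 : 0 ≤ h
  h1 : h ≤ k
  lo : ∀ n : ℕ, Real.exp (h * n) ≤ Z n
  sm : ∀ t : ℝ, 0 ≤ t → t < Real.exp (-h) → Summable (fun n => Z n * t ^ n)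

lemma summ_d {k : ℕ} {d : ℕ → ℝ} (hd : ∀ j, |d j| ≤ k) {t : ℝ} (h0 : 0 ≤ t) (h1 : t < 1) :
    Summable (fun j => ‖d j * t ^ j‖) := by
  refine Summable.of_nonneg_of_le (fun j => norm_nonneg _) (fun j => ?_)
    ((summable_geometric_of_lt_one h0 h1).mul_left (k : ℝ))
  rw [norm_mul, Real.norm_eq_abs, norm_pow, Real.norm_of_nonneg h0]
  exact mul_le_mul_of_nonneg_right (hd j) (by positivity)

lemma GoodSeq.key {k : ℕ} {d Z : ℕ → ℝ} {h : ℝ} (g : GoodSeq k d Z h) {t : ℝ} (h0 : 0 ≤ t)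
    (h1 : t < Real.exp (-h)) : Gfun d t * ∑' n, Z n * t ^ n = 1 := by
  have t1 : t < 1 := h1.trans_le (Real.exp_le_one_iff.2 (by linarith [g.h0]))
  have sZ := g.sm t h0 h1
  have sd := summ_d g.bd h0 t1
  have sg := summable_geometric_of_lt_one h0 t1
  have cau := tsum_mul_tsum_eq_tsum_sum_range_of_summable_norm sd sZ.norm
  have scau := (summable_norm_sum_mul_range_of_summable_norm sd sZ.norm).of_norm
  have e1 : ∑' n, Z n * t ^ n = 1 + t * ∑' n, Z (n + 1) * t ^ n := by
    rw [sZ.tsum_eq_zero_add, g.z0, ← tsum_mul_left]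
    simp only [pow_zero, mul_one]
    congr 2; ext n; ring
  have e2 : ∑' n, Z (n + 1) * t ^ n = ∑' n, t ^ n +
      (∑' j, d j * t ^ j) * ∑' n, Z n * t ^ n := by
    rw [cau, ← sg.tsum_add scau]
    congr 1; ext n
    rw [g.ren, add_mul, one_mul, Finset.sum_mul]
    congr 1
    refine Finset.sum_congr rfl fun j hj => ?_
    have : j ≤ n := by simp at hj; omega
    conv_lhs => rw [← Nat.add_sub_of_le this, pow_add]
    simp; ring
  rw [tsum_geometric_of_lt_one h0 t1] at e2
  rw [e2] at e1
  have : (1 - t) ≠ 0 := by linarith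
  unfold Gfun
  set Y := ∑' n, Z n * t ^ n
  set D := ∑' j, d j * t ^ j
  have e3 : (1 - t) * Y = (1 - t) + t * (1 + (1 - t) * D * Y) := by
    conv_lhs => rw [e1]
    field_simp
  linear_combination e3

lemma GoodSeq.Zpos {k : ℕ} {d Z : ℕ → ℝ} {h : ℝ} (g : GoodSeq k d Z h) {t : ℝ} (h0 : 0 ≤ t)
    (h1 : t < Real.exp (-h)) : 0 < ∑' n, Z n * t ^ n := by
  refine (g.sm t h0 h1).tsum_pos (fun n => mul_nonneg (g.nn n) (by positivity)) 0 ?_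
  simp [g.z0]

lemma GoodSeq.pos {k : ℕ} {d Z : ℕ → ℝ} {h : ℝ} (g : GoodSeq k d Z h) {t : ℝ} (h0 : 0 ≤ t)
    (h1 : t < Real.exp (-h)) : 0 ≤ Gfun d t := by
  have := g.key h0 h1
  have h2 := g.Zpos h0 h1
  by_contra hc
  push Not at hc
  nlinarith

lemma GoodSeq.anti {k : ℕ} {d Z : ℕ → ℝ} {h : ℝ} (g : GoodSeq k d Z h) {s t : ℝ} (h0 : 0 ≤ s)
    (st : s ≤ t) (h1 : t < Real.exp (-h)) : Gfun d t ≤ Gfun d s := by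
  have h1s := st.trans_lt h1
  have h0t := h0.trans st
  have a := g.key h0 h1s
  have b := g.key h0t h1
  have hs := g.Zpos h0 h1s
  have ht := g.Zpos h0t h1
  have : ∑' n, Z n * s ^ n ≤ ∑' n, Z n * t ^ n := by
    refine (g.sm s h0 h1s).tsum_le_tsum (fun n => ?_) (g.sm t h0t h1)
    exact mul_le_mul_of_nonneg_left (pow_le_pow_left₀ h0 st n) (g.nn n)
  rw [eq_div_of_mul_eq hs.ne' a, eq_div_of_mul_eq ht.ne' b]
  exact one_div_le_one_div_of_le hs this

lemma GoodSeq.up {k : ℕ} {d Z : ℕ → ℝ} {h : ℝ} (g : GoodSeq k d Z h) {t : ℝ} (h0 : 0 ≤ t)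
    (h1 : t < Real.exp (-h)) : Gfun d t ≤ 1 - t * Real.exp h := by
  have a := g.key h0 h1
  have hs := g.Zpos h0 h1
  have q1 : t * Real.exp h < 1 := by
    calc t * Real.exp h < Real.exp (-h) * Real.exp h :=
          mul_lt_mul_of_pos_right h1 (Real.exp_pos _)
      _ = 1 := by rw [← Real.exp_add]; simp
  have q0 : 0 ≤ t * Real.exp h := by positivity
  have : (1 - t * Real.exp h)⁻¹ ≤ ∑' n, Z n * t ^ n := by
    rw [← tsum_geometric_of_lt_one q0 q1]
    refine (summable_geometric_of_lt_one q0 q1).tsum_le_tsum (fun n => ?_) (g.sm t h0 h1)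
    rw [mul_pow, ← Real.exp_nat_mul, mul_comm (n : ℝ) h, mul_comm]
    exact mul_le_mul_of_nonneg_right (g.lo n) (by positivity)
  rw [eq_div_of_mul_eq hs.ne' a, one_div]
  exact inv_le_of_inv_le₀ (by linarith) this

lemma Gfun_tendsto {k : ℕ} {d : ℕ → ℕ → ℝ} {d₀ : ℕ → ℝ} (hd : ∀ i j, |d i j| ≤ k)
    (hl : Tendsto d atTop (𝓝 d₀)) {t : ℝ} (h0 : 0 ≤ t) (h1 : t < 1) :
    Tendsto (fun i => Gfun (d i) t) atTop (𝓝 (Gfun d₀ t)) := by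
  unfold Gfun
  refine Tendsto.mul_const _ (Tendsto.const_sub _ (Tendsto.const_mul _ ?_))
  refine tendsto_tsum_of_dominated_convergence (bound := fun j => k * t ^ j)
    ((summable_geometric_of_lt_one h0 h1).mul_left (k : ℝ)) (fun j => ?_)
    (Eventually.of_forall fun i j => ?_)
  · exact ((tendsto_pi_nhds.1 hl) j).mul_const _
  · rw [norm_mul, Real.norm_eq_abs, norm_pow, Real.norm_of_nonneg h0]
    exact mul_le_mul_of_nonneg_right (hd i j) (by positivity)

lemma Gfun_analytic {k : ℕ} {d : ℕ → ℝ} (hd : ∀ j, |d j| ≤ k) :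
    AnalyticOnNhd ℝ (Gfun d) (Metric.ball 0 1) := by
  have hr : (1 : ENNReal) ≤ (FormalMultilinearSeries.ofScalars ℝ d).radius := by
    refine (FormalMultilinearSeries.ofScalars ℝ d).le_radius_of_bound (r := 1) k fun n => ?_
    simpa [FormalMultilinearSeries.ofScalars_norm] using hd n
  have hp := ((FormalMultilinearSeries.ofScalars ℝ d).hasFPowerSeriesOnBall
    (lt_of_lt_of_le zero_lt_one hr)).mono zero_lt_one hr
  have ha := hp.analyticOnNhd
  have : Metric.eball (0 : ℝ) 1 = Metric.ball 0 1 := by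
    have := Metric.eball_ofReal (x := (0:ℝ)) (ε := 1)
    simpa using this
  rw [this] at ha
  have hs : (FormalMultilinearSeries.ofScalars ℝ d).sum = fun t => ∑' j, d j * t ^ j := by
    ext t
    simp [FormalMultilinearSeries.sum, mul_comm]
  rw [hs] at ha
  exact (analyticOnNhd_const.sub (analyticOnNhd_id.mul ha)).mul
    (analyticOnNhd_const.sub analyticOnNhd_id)

theorem goodSeq_cont (k : ℕ) (δ : ℝ) (hδ : 0 < δ) : ∃ L : ℕ, ∀ (d d' Z Z' : ℕ → ℝ) (h h' : ℝ),
    GoodSeq k d Z h → GoodSeq k d' Z' h' → (∀ i < L, d i = d' i) → h' ≤ h + δ := by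
  by_contra hc
  push Not at hc
  choose d d' Z Z' h h' g g' ag hh using hc
  have hK : IsCompact ((Set.univ.pi fun _ : ℕ => Set.Icc (-(k : ℝ)) k) ×ˢ
      (Set.Icc (0 : ℝ) k ×ˢ Set.Icc (0 : ℝ) k)) :=
    (isCompact_univ_pi fun _ => isCompact_Icc).prod (isCompact_Icc.prod isCompact_Icc)
  obtain ⟨⟨d₀, a, a'⟩, -, φ, hφ, hlim⟩ := hK.tendsto_subseq (x := fun n => (d n, h n, h' n))
    (fun n => ⟨fun j _ => abs_le.1 ((g n).bd j), ⟨(g n).h0, (g n).h1⟩, ⟨(g' n).h0, (g' n).h1⟩⟩)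
  have l1 : Tendsto (fun i => d (φ i)) atTop (𝓝 d₀) := (continuous_fst.tendsto _).comp hlim
  have l2 : Tendsto (fun i => h (φ i)) atTop (𝓝 a) :=
    ((continuous_fst.comp continuous_snd).tendsto _).comp hlim
  have l3 : Tendsto (fun i => h' (φ i)) atTop (𝓝 a') :=
    ((continuous_snd.comp continuous_snd).tendsto _).comp hlim
  have l1' : Tendsto (fun i => d' (φ i)) atTop (𝓝 d₀) := by
    rw [tendsto_pi_nhds] at l1 ⊢
    intro j
    refine (l1 j).congr' ?_
    filter_upwards [eventually_gt_atTop j] with i hi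
    exact ag _ _ (hi.trans_le hφ.le_apply)
  have haa : a + δ ≤ a' :=
    le_of_tendsto_of_tendsto (l2.add_const δ) l3 (Eventually.of_forall fun i => (hh (φ i)).le)
  have ha0 : 0 ≤ a := ge_of_tendsto l2 (Eventually.of_forall fun i => (g (φ i)).h0)
  have bd0 : ∀ j, |d₀ j| ≤ k := fun j =>
    le_of_tendsto ((tendsto_pi_nhds.1 l1 j).abs) (Eventually.of_forall fun i => (g (φ i)).bd j)
  set r := Real.exp (-a) with hr
  set r' := Real.exp (-a') with hr'
  have rr : r' < r := Real.exp_lt_exp.2 (by linarith)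
  have r1 : r ≤ 1 := Real.exp_le_one_iff.2 (by linarith)
  have r'0 : 0 < r' := Real.exp_pos _
  have er : Tendsto (fun i => Real.exp (-h (φ i))) atTop (𝓝 r) :=
    (Real.continuous_exp.tendsto _).comp l2.neg
  have er' : Tendsto (fun i => Real.exp (-h' (φ i))) atTop (𝓝 r') :=
    (Real.continuous_exp.tendsto _).comp l3.neg
  have G0 : ∀ t, 0 ≤ t → t < r → 0 ≤ Gfun d₀ t := fun t h0 h1 => by
    refine ge_of_tendsto (Gfun_tendsto (fun i j => (g (φ i)).bd j) l1 h0 (h1.trans_le r1)) ?_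
    filter_upwards [er.eventually_const_lt h1] with i hi using (g (φ i)).pos h0 hi
  have Ga : ∀ s t, 0 ≤ s → s ≤ t → t < r → Gfun d₀ t ≤ Gfun d₀ s := fun s t h0 st h1 => by
    refine le_of_tendsto_of_tendsto
      (Gfun_tendsto (fun i j => (g (φ i)).bd j) l1 (h0.trans st) (h1.trans_le r1))
      (Gfun_tendsto (fun i j => (g (φ i)).bd j) l1 h0 ((st.trans_lt h1).trans_le r1)) ?_
    filter_upwards [er.eventually_const_lt h1] with i hi using (g (φ i)).anti h0 st hi
  have Gu : ∀ t, 0 ≤ t → t < r' → Gfun d₀ t ≤ 1 - t * Real.exp a' := fun t h0 h1 => by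
    refine le_of_tendsto_of_tendsto
      (Gfun_tendsto (fun i j => (g' (φ i)).bd j) l1' h0 ((h1.trans rr).trans_le r1))
      (Tendsto.const_sub _ (Tendsto.const_mul _ ((Real.continuous_exp.tendsto _).comp l3))) ?_
    filter_upwards [er'.eventually_const_lt h1] with i hi using (g' (φ i)).up h0 hi
  have an := Gfun_analytic bd0
  have Gr' : Gfun d₀ r' ≤ 0 := by
    have c : ContinuousAt (Gfun d₀) r' :=
      (an r' (by simp [abs_of_pos r'0]; linarith)).continuousAt
    have c1 : Tendsto (Gfun d₀) (𝓝[<] r') (𝓝 (Gfun d₀ r')) := c.tendsto.mono_left nhdsWithin_le_nhds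
    have c2 : Tendsto (fun t => 1 - t * Real.exp a') (𝓝[<] r') (𝓝 (1 - r' * Real.exp a')) :=
      (Continuous.tendsto (by fun_prop) _).mono_left nhdsWithin_le_nhds
    have : 1 - r' * Real.exp a' = 0 := by rw [hr', ← Real.exp_add]; simp
    rw [this] at c2
    refine le_of_tendsto_of_tendsto c1 c2 ?_
    filter_upwards [Ioo_mem_nhdsLT r'0] with t ht using Gu t ht.1.le ht.2
  have Gz : ∀ t, r' < t → t < r → Gfun d₀ t = 0 := fun t h1 h2 =>
    le_antisymm ((Ga r' t r'0.le h1.le h2).trans Gr') (G0 t (r'0.le.trans h1.le) h2)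
  have := an.eqOn_zero_of_preconnected_of_eventuallyEq_zero (z₀ := (r' + r) / 2)
    (convex_ball (0:ℝ) 1).isPreconnected
    (by simp; rw [abs_of_pos (by linarith)]; linarith)
    (by filter_upwards [Ioo_mem_nhds (show r' < (r' + r) / 2 by linarith)
          (show (r' + r) / 2 < r by linarith)] with t ht using Gz t ht.1 ht.2)
  have := this (show (0:ℝ) ∈ Metric.ball (0:ℝ) 1 by simp)
  simp [Gfun] at this

end analytic

/-! ### Lexicographic order -/

def scons {k : ℕ} (a : Fin k) (w : ℕ → Fin k) : ℕ → Fin k := fun n => Nat.casesOn n a w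

@[simp] lemma scons_zero {k : ℕ} (a : Fin k) (w : ℕ → Fin k) : scons a w 0 = a := rfl
@[simp] lemma scons_succ {k : ℕ} (a : Fin k) (w : ℕ → Fin k) (n : ℕ) :
    scons a w (n + 1) = w n := rfl
@[simp] lemma shiftF_scons {k : ℕ} (a : Fin k) (w : ℕ → Fin k) : shiftF (scons a w) = w := rfl
lemma scons_eta {k : ℕ} (x : ℕ → Fin k) : scons (x 0) (shiftF x) = x := by
  ext n; cases n <;> rfl

lemma shiftF_iter {k : ℕ} (x : ℕ → Fin k) (n i : ℕ) : (shiftF^[n] x) i = x (n + i) := by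
  induction n generalizing x with
  | zero => simp
  | succ n ih => rw [Function.iterate_succ_apply, ih]; simp only [shiftF]; congr 1; omega

lemma LexLe.iff_toLex {k : ℕ} {x y : ℕ → Fin k} : LexLe x y ↔ toLex x ≤ toLex y := by
  rw [le_iff_eq_or_lt]
  rfl

lemma LexLe.refl {k : ℕ} (x : ℕ → Fin k) : LexLe x x := Or.inl rfl
lemma LexLe.trans {k : ℕ} {x y z : ℕ → Fin k} (h : LexLe x y) (h' : LexLe y z) : LexLe x z := by
  rw [LexLe.iff_toLex] at *; exact h.trans h'
lemma LexLe.total {k : ℕ} (x y : ℕ → Fin k) : LexLe x y ∨ LexLe y x := by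
  simp only [LexLe.iff_toLex]; exact le_total _ _
lemma LexLe.antisymm {k : ℕ} {x y : ℕ → Fin k} (h : LexLe x y) (h' : LexLe y x) : x = y := by
  rw [LexLe.iff_toLex] at *; exact toLex_inj.1 (le_antisymm h h')

lemma LexLe.iff_head {k : ℕ} {x y : ℕ → Fin k} :
    LexLe x y ↔ x 0 < y 0 ∨ x 0 = y 0 ∧ LexLe (shiftF x) (shiftF y) := by
  constructor
  · rintro (rfl | ⟨n, hn, hlt⟩)
    · exact Or.inr ⟨rfl, LexLe.refl _⟩
    · cases n with
      | zero => exact Or.inl hlt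
      | succ n =>
        exact Or.inr ⟨hn 0 (by omega), Or.inr ⟨n, fun m hm => hn (m + 1) (by omega), hlt⟩⟩
  · rintro (h | ⟨h, h' | ⟨n, hn, hlt⟩⟩)
    · exact Or.inr ⟨0, by simp, h⟩
    · left; rw [← scons_eta x, ← scons_eta y, h, h']
    · refine Or.inr ⟨n + 1, fun m hm => ?_, hlt⟩
      cases m with
      | zero => exact h
      | succ m => exact hn m (by omega)

lemma LexLe.head_le {k : ℕ} {x y : ℕ → Fin k} (h : LexLe x y) : x 0 ≤ y 0 := by
  rcases LexLe.iff_head.1 h with h | h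
  · exact h.le
  · exact h.1.le

lemma LexLe.sandwich {k : ℕ} {n : ℕ} : ∀ {x y z : ℕ → Fin k}, LexLe x y → LexLe y z →
    (∀ i < n, x i = z i) → ∀ i < n, x i = y i := by
  induction n with
  | zero => intro x y z _ _ _ i hi; omega
  | succ n ih =>
    intro x y z h1 h2 h i hi
    have h0 : x 0 = z 0 := h 0 (by omega)
    have e1 : x 0 = y 0 := le_antisymm h1.head_le (h0 ▸ h2.head_le)
    have e2 : y 0 = z 0 := e1 ▸ h0
    have l1 : LexLe (shiftF x) (shiftF y) := by
      rcases LexLe.iff_head.1 h1 with h | h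
      · exact absurd h (by rw [e1]; exact lt_irrefl _)
      · exact h.2
    have l2 : LexLe (shiftF y) (shiftF z) := by
      rcases LexLe.iff_head.1 h2 with h | h
      · exact absurd h (by rw [e2]; exact lt_irrefl _)
      · exact h.2
    cases i with
    | zero => exact e1
    | succ i => exact ih l1 l2 (fun j hj => h (j + 1) (by omega)) i (by omega)

lemma mem_SigmaUV_iff {k : ℕ} {u v x : ℕ → Fin k} :
    x ∈ SigmaUV u v ↔ LexLe u x ∧ LexLe x v ∧ shiftF x ∈ SigmaUV u v := by
  constructor
  · intro h
    exact ⟨(h 0).1, (h 0).2, fun n => h (n + 1)⟩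
  · rintro ⟨h1, h2, h3⟩ n
    cases n with
    | zero => exact ⟨h1, h2⟩
    | succ n => exact h3 n

lemma shift_mem {k : ℕ} {u v x : ℕ → Fin k} (h : x ∈ SigmaUV u v) : shiftF x ∈ SigmaUV u v :=
  (mem_SigmaUV_iff.1 h).2.2

lemma iter_mem {k : ℕ} {u v x : ℕ → Fin k} (h : x ∈ SigmaUV u v) (n : ℕ) :
    shiftF^[n] x ∈ SigmaUV u v := by
  induction n with
  | zero => exact h
  | succ n ih => rw [Function.iterate_succ_apply']; exact shift_mem ih

/-! ### Counting words -/

def res {k : ℕ} (n : ℕ) (z : ℕ → Fin k) : Fin n → Fin k := fun i => z i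

lemma res_eq_iff {k n : ℕ} {x y : ℕ → Fin k} : res n x = res n y ↔ ∀ i < n, x i = y i :=
  ⟨fun h i hi => congrFun h ⟨i, hi⟩, fun h => funext fun i => h i i.2⟩

noncomputable def NW {k : ℕ} (n : ℕ) (A : Set (ℕ → Fin k)) : ℕ := (res n '' A).ncard

@[simp] lemma NW_empty {k n : ℕ} : NW n (∅ : Set (ℕ → Fin k)) = 0 := by simp [NW]
@[simp] lemma NW_singleton {k n : ℕ} (x : ℕ → Fin k) : NW n {x} = 1 := by simp [NW]

lemma NW_pos {k n : ℕ} {A : Set (ℕ → Fin k)} (h : A.Nonempty) : 0 < NW n A :=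
  (Set.ncard_pos (Set.toFinite _)).2 (h.image _)

lemma NW_zero {k : ℕ} {A : Set (ℕ → Fin k)} (h : A.Nonempty) : NW 0 A = 1 := by
  refine le_antisymm ?_ (NW_pos h)
  exact Set.ncard_le_one_of_subsingleton _

lemma NW_le_pow {k n : ℕ} (A : Set (ℕ → Fin k)) : NW n A ≤ k ^ n := by
  have := Set.ncard_le_ncard (Set.subset_univ (res n '' A)) (Set.toFinite _)
  simpa [NW, Set.ncard_univ] using this

lemma NW_succ {k n : ℕ} (A : Set (ℕ → Fin k)) :
    NW (n + 1) A = ∑ a : Fin k, NW n {w | scons a w ∈ A} := by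
  have e : res (n + 1) '' A =
      ⋃ a : Fin k, (fun w : Fin n → Fin k => (Fin.cons a w : Fin (n + 1) → Fin k)) ''
        (res n '' {w | scons a w ∈ A}) := by
    have key : ∀ (a : Fin k) (w : ℕ → Fin k),
        (Fin.cons a (res n w) : Fin (n + 1) → Fin k) = res (n + 1) (scons a w) := by
      intro a w
      ext i
      refine Fin.cases ?_ (fun i => ?_) i <;> simp [res]
    ext p
    simp only [Set.mem_image, Set.mem_iUnion, Set.mem_ofPred_eq]
    constructor
    · rintro ⟨x, hx, rfl⟩
      exact ⟨x 0, _, ⟨shiftF x, by rwa [scons_eta], rfl⟩, by rw [key, scons_eta]⟩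
    · rintro ⟨a, _, ⟨w, hw, rfl⟩, rfl⟩
      exact ⟨_, hw, (key a w).symm⟩
  unfold NW
  rw [e, Set.ncard_iUnion_of_finite (fun _ => Set.toFinite _), finsum_eq_sum_of_fintype]
  · refine Finset.sum_congr rfl fun a _ => ?_
    exact Set.ncard_image_of_injective _ (Fin.cons_right_injective (α := fun _ => Fin k) a)
  · intro a b hab
    rw [Function.onFun, Set.disjoint_left]
    rintro _ ⟨p, _, rfl⟩ ⟨q, _, h⟩
    exact hab (by simpa using (congrFun h 0).symm)

lemma NW_submul {k : ℕ} (u v : ℕ → Fin k) (m n : ℕ) :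
    NW (m + n) (SigmaUV u v) ≤ NW m (SigmaUV u v) * NW n (SigmaUV u v) := by
  unfold NW
  rw [← Set.ncard_prod]
  refine Set.ncard_le_ncard_of_injOn
    (fun w => (fun i => w (Fin.castAdd n i), fun i => w (Fin.natAdd m i))) ?_ ?_ (Set.toFinite _)
  · rintro _ ⟨x, hx, rfl⟩
    refine ⟨⟨x, hx, rfl⟩, ⟨shiftF^[m] x, iter_mem hx m, ?_⟩⟩
    ext i
    simp [res, shiftF_iter]
  · intro p _ q _ h
    simp only [Prod.mk.injEq] at h
    ext i
    refine Fin.addCases (fun i => ?_) (fun i => ?_) i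
    · rw [congrFun h.1 i]
    · rw [congrFun h.2 i]

lemma NW_split {k n : ℕ} {S : Set (ℕ → Fin k)} {x y : ℕ → Fin k} (hx : x ∈ S) (_hy : y ∈ S)
    (hxy : LexLe x y) :
    NW n {w | w ∈ S ∧ LexLe x w ∧ LexLe w y} + NW n S =
      NW n {w | w ∈ S ∧ LexLe x w} + NW n {w | w ∈ S ∧ LexLe w y} := by
  unfold NW
  rw [← Set.ncard_union_add_ncard_inter (res n '' {w | w ∈ S ∧ LexLe x w}), add_comm]
  congr 2
  · rw [← Set.image_union]
    congr 1
    ext w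
    constructor
    · intro hw
      rcases LexLe.total x w with h | h
      · exact Or.inl ⟨hw, h⟩
      · exact Or.inr ⟨hw, h.trans hxy⟩
    · rintro (h | h) <;> exact h.1
  · ext p
    constructor
    · rintro ⟨w, hw, rfl⟩
      exact ⟨⟨w, ⟨hw.1, hw.2.1⟩, rfl⟩, ⟨w, ⟨hw.1, hw.2.2⟩, rfl⟩⟩
    · rintro ⟨⟨w, hw, rfl⟩, ⟨w', hw', e⟩⟩
      rcases LexLe.total x w' with h | h
      · exact ⟨w', ⟨hw'.1, h, hw'.2⟩, e⟩
      · refine ⟨x, ⟨hx, LexLe.refl _, hxy⟩, ?_⟩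
        rw [← e]
        exact (res_eq_iff.2 (LexLe.sandwich h hw.2 (res_eq_iff.1 e))).symm

lemma sumA {k : ℕ} (c : Fin k) (Q Z : ℤ) (f : Fin k → ℤ) (h0 : ∀ a, a < c → f a = 0)
    (h1 : f c = Q) (h2 : ∀ a, c < a → f a = Z) : ∑ a, f a = Q + (k - 1 - (c : ℕ)) * Z := by
  have : ∀ a, f a = (if a = c then Q else 0) + (if c < a then Z else 0) := by
    intro a
    rcases lt_trichotomy a c with h | h | h
    · simp [h0 a h, h.ne, h.not_gt]
    · subst h; simp [h1]
    · simp [h2 a h, h.ne', h]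
  simp only [this, Finset.sum_add_distrib, Finset.sum_ite_eq', Finset.mem_univ, if_true]
  rw [← Finset.sum_filter, Finset.sum_const, Finset.filter_lt_eq_Ioi, Fin.card_Ioi]
  have := c.2
  simp only [nsmul_eq_mul]
  congr 2
  omega

lemma sumB {k : ℕ} (c : Fin k) (Q Z : ℤ) (f : Fin k → ℤ) (h0 : ∀ a, a < c → f a = Z)
    (h1 : f c = Q) (h2 : ∀ a, c < a → f a = 0) : ∑ a, f a = Q + (c : ℕ) * Z := by
  have : ∀ a, f a = (if a = c then Q else 0) + (if a < c then Z else 0) := by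
    intro a
    rcases lt_trichotomy a c with h | h | h
    · simp [h0 a h, h.ne, h]
    · subst h; simp [h1]
    · simp [h2 a h, h.ne', h.not_gt]
  simp only [this, Finset.sum_add_distrib, Finset.sum_ite_eq', Finset.mem_univ, if_true]
  rw [← Finset.sum_filter, Finset.sum_const, Finset.filter_gt_eq_Iio, Fin.card_Iio]
  simp only [nsmul_eq_mul]

noncomputable def PW {k : ℕ} (u v : ℕ → Fin k) (n : ℕ) (y : ℕ → Fin k) : ℤ :=
  NW n {w | w ∈ SigmaUV u v ∧ LexLe w y}

lemma PW_succ {k : ℕ} {u v y : ℕ → Fin k} (hu : u ∈ SigmaUV u v) (hy : y ∈ SigmaUV u v) (n : ℕ) :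
    PW u v (n + 1) y = 1 + PW u v n (shiftF y) - PW u v n (shiftF u) +
      ((y 0 : ℕ) - (u 0 : ℕ)) * (NW n (SigmaUV u v) : ℤ) := by
  set S := SigmaUV u v with hS
  have huy : LexLe u y := (hy 0).1
  have hsu := shift_mem hu
  have hsy := shift_mem hy
  have hh := huy.head_le
  have sec : ∀ a : Fin k, {w | scons a w ∈ {w | w ∈ S ∧ LexLe w y}} =
      {w | w ∈ S ∧ LexLe u (scons a w) ∧ LexLe (scons a w) y} := by
    intro a
    ext w
    simp only [Set.mem_ofPred_eq, hS]
    rw [mem_SigmaUV_iff, shiftF_scons]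
    constructor
    · tauto
    · rintro ⟨h1, h2, h3⟩
      exact ⟨⟨h2, h3.trans (hy 0).2, h1⟩, h3⟩
  have Aeq : ∀ a (w : ℕ → Fin k), LexLe u (scons a w) ↔ u 0 < a ∨ u 0 = a ∧ LexLe (shiftF u) w :=
    fun a w => LexLe.iff_head
  have Beq : ∀ a (w : ℕ → Fin k), LexLe (scons a w) y ↔ a < y 0 ∨ a = y 0 ∧ LexLe w (shiftF y) :=
    fun a w => LexLe.iff_head
  have ie : ∀ a : Fin k, (NW n {w | w ∈ S ∧ LexLe u (scons a w) ∧ LexLe (scons a w) y} : ℤ) =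
      NW n {w | w ∈ S ∧ LexLe u (scons a w)} + NW n {w | w ∈ S ∧ LexLe (scons a w) y} -
        NW n S := by
    intro a
    by_cases h1 : u 0 < a
    · simp [Aeq, h1]
    · by_cases h2 : a < y 0
      · simp [Beq, h2]
      · have e1 : u 0 = a := le_antisymm (hh.trans (not_lt.1 h2)) (not_lt.1 h1)
        have e2 : a = y 0 := le_antisymm ((not_lt.1 h1).trans hh) (not_lt.1 h2)
        have l : LexLe (shiftF u) (shiftF y) := by
          rcases LexLe.iff_head.1 huy with h | h
          · exact absurd h (by rw [e1, e2]; exact lt_irrefl _)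
          · exact h.2
        have := NW_split (n := n) hsu hsy l
        simp only [Aeq, Beq, e1, lt_irrefl, false_or, true_and, ← e2]
        rw [← hS] at this
        push_cast [← Nat.cast_inj (R := ℤ)] at this
        linarith
  have sA := sumA (u 0) (NW n {w | w ∈ S ∧ LexLe (shiftF u) w}) (NW n S)
    (fun a => (NW n {w | w ∈ S ∧ LexLe u (scons a w)} : ℤ))
    (fun a h => by simp [Aeq, h.not_gt, h.ne']) (by simp [Aeq]) (fun a h => by simp [Aeq, h])
  have sB := sumB (y 0) (NW n {w | w ∈ S ∧ LexLe w (shiftF y)}) (NW n S)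
    (fun a => (NW n {w | w ∈ S ∧ LexLe (scons a w) y} : ℤ))
    (fun a h => by simp [Beq, h]) (by simp [Beq]) (fun a h => by simp [Beq, h.not_gt, h.ne'])
  have one : (1 : ℤ) + NW n S = NW n {w | w ∈ S ∧ LexLe (shiftF u) w} + PW u v n (shiftF u) := by
    have := NW_split (n := n) hsu hsu (LexLe.refl _)
    have e : {w | w ∈ SigmaUV u v ∧ LexLe (shiftF u) w ∧ LexLe w (shiftF u)} = {shiftF u} := by
      ext w
      constructor
      · rintro ⟨_, h, h'⟩
        exact h'.antisymm h
      · rintro rfl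
        exact ⟨hsu, LexLe.refl _, LexLe.refl _⟩
    rw [e, NW_singleton] at this
    unfold PW
    exact_mod_cast this
  have tot : PW u v (n + 1) y = ∑ a : Fin k,
      ((NW n {w | w ∈ S ∧ LexLe u (scons a w)} : ℤ) + NW n {w | w ∈ S ∧ LexLe (scons a w) y} -
        NW n S) := by
    unfold PW
    rw [NW_succ, Nat.cast_sum]
    refine Finset.sum_congr rfl fun a _ => ?_
    rw [← ie, ← sec]
  rw [tot, Finset.sum_sub_distrib, Finset.sum_add_distrib, sA, sB]
  simp only [Finset.sum_const, Finset.card_univ, Fintype.card_fin, nsmul_eq_mul]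
  have : PW u v n (shiftF y) = NW n {w | w ∈ S ∧ LexLe w (shiftF y)} := rfl
  rw [this]
  linear_combination -one

lemma PW_diff {k : ℕ} {u v : ℕ → Fin k} (hu : u ∈ SigmaUV u v) (n : ℕ) : ∀ {x y : ℕ → Fin k},
    x ∈ SigmaUV u v → y ∈ SigmaUV u v → PW u v n y - PW u v n x =
      ∑ j ∈ Finset.range n, (((y j : ℕ) : ℤ) - (x j : ℕ)) * NW (n - 1 - j) (SigmaUV u v) := by
  induction n with
  | zero =>
    intro x y hx hy
    have : ∀ z, z ∈ SigmaUV u v → PW u v 0 z = 1 := fun z hz => by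
      unfold PW
      have hne : {w | w ∈ SigmaUV u v ∧ LexLe w z}.Nonempty := ⟨z, hz, LexLe.refl _⟩
      rw [NW_zero hne]; rfl
    simp [this x hx, this y hy]
  | succ n ih =>
    intro x y hx hy
    rw [PW_succ hu hx, PW_succ hu hy, Finset.sum_range_succ']
    have := ih (shift_mem hx) (shift_mem hy)
    have e : ∑ j ∈ Finset.range n, (((y (j + 1) : ℕ) : ℤ) - (x (j + 1) : ℕ)) *
        NW (n + 1 - 1 - (j + 1)) (SigmaUV u v) = ∑ j ∈ Finset.range n,
        (((shiftF y j : ℕ) : ℤ) - (shiftF x j : ℕ)) * NW (n - 1 - j) (SigmaUV u v) := by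
      refine Finset.sum_congr rfl fun j _ => ?_
      have : n + 1 - 1 - (j + 1) = n - 1 - j := by omega
      rw [this]; rfl
    rw [e, ← this]
    simp
    ring

lemma NW_renewal {k : ℕ} {u v : ℕ → Fin k} (h : Admissible u v) (n : ℕ) :
    (NW (n + 1) (SigmaUV u v) : ℝ) = 1 + ∑ j ∈ Finset.range (n + 1),
      (((v j : ℕ) : ℝ) - (u j : ℕ)) * NW (n - j) (SigmaUV u v) := by
  have hu : u ∈ SigmaUV u v := fun n => ⟨(h n).1, (h n).2.1⟩
  have hv : v ∈ SigmaUV u v := fun n => ⟨(h n).2.2.1, (h n).2.2.2⟩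
  have := PW_diff hu (n + 1) hu hv
  have e1 : PW u v (n + 1) v = NW (n + 1) (SigmaUV u v) := by
    unfold PW
    congr 2
    ext w
    exact ⟨fun h => h.1, fun h => ⟨h, (h 0).2⟩⟩
  have e2 : PW u v (n + 1) u = 1 := by
    unfold PW
    have : {w | w ∈ SigmaUV u v ∧ LexLe w u} = {u} := by
      ext w
      constructor
      · rintro ⟨h, h'⟩
        exact h'.antisymm (h 0).1
      · rintro rfl
        exact ⟨hu, LexLe.refl _⟩
    rw [this, NW_singleton]; rfl
  rw [e1, e2] at this
  simp only [Nat.add_sub_cancel] at this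
  have h2 : (NW (n + 1) (SigmaUV u v) : ℤ) = 1 + ∑ j ∈ Finset.range (n + 1),
      (((v j : ℕ) : ℤ) - (u j : ℕ)) * NW (n - j) (SigmaUV u v) := by linarith
  exact_mod_cast h2

/-! ### Entropy -/

lemma mem_unif_zero (k : ℕ) :
    {p : (ℕ → Fin k) × (ℕ → Fin k) | p.1 0 = p.2 0} ∈ uniformity (ℕ → Fin k) := by
  rw [Pi.uniformity]
  refine Filter.mem_iInf_of_mem 0 ?_
  refine Filter.mem_comap.2 ⟨{p | p.1 = p.2}, ?_, fun p hp => hp⟩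
  change _ ∈ Filter.principal _
  exact Filter.mem_principal.2 (fun p hp => hp)

lemma exists_depth {k : ℕ} {U : Set ((ℕ → Fin k) × (ℕ → Fin k))}
    (hU : U ∈ uniformity (ℕ → Fin k)) :
    ∃ N : ℕ, ∀ x y : ℕ → Fin k, (∀ i < N, x i = y i) → (x, y) ∈ U := by
  have le : (⨅ N : ℕ, Filter.principal
      {p : (ℕ → Fin k) × (ℕ → Fin k) | ∀ i < N, p.1 i = p.2 i}) ≤ uniformity (ℕ → Fin k) := by
    rw [Pi.uniformity]
    refine le_iInf fun i => ?_
    refine (iInf_le _ (i + 1)).trans ?_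
    rw [← Filter.map_le_iff_le_comap, Filter.map_principal]
    change _ ≤ Filter.principal _
    rw [Filter.principal_mono]
    rintro _ ⟨p, hp, rfl⟩
    exact hp i (by omega)
  have hd : Directed (· ≥ ·) (fun N : ℕ => Filter.principal
      {p : (ℕ → Fin k) × (ℕ → Fin k) | ∀ i < N, p.1 i = p.2 i}) := by
    refine directed_of_isDirected_le fun a b hab => ?_
    rw [ge_iff_le, Filter.principal_mono]
    exact fun p hp i hi => hp i (by omega)
  obtain ⟨N, hN⟩ := (Filter.mem_iInf_of_directed hd U).1 (le hU)
  exact ⟨N, fun x y h => hN h⟩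

lemma NW_le_mincard {k : ℕ} (F : Set (ℕ → Fin k)) (n : ℕ) :
    ((NW n F : ℕ) : ℕ∞) ≤ coverMincard shiftF F {p | p.1 0 = p.2 0} n := by
  refine le_iInf₂ fun s hs => ?_
  have : res n '' F ⊆ res n '' (s : Set (ℕ → Fin k)) := by
    rintro _ ⟨x, hx, rfl⟩
    obtain ⟨y, hy, h⟩ := hs hx
    refine ⟨y, hy, res_eq_iff.2 fun i hi => ?_⟩
    have := (mem_dynEntourage.1 h) i hi
    simpa [shiftF_iter] using this.symm
  have h1 := Set.ncard_le_ncard this (Set.toFinite _)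
  have h2 := Set.ncard_image_le (f := res n) s.finite_toSet
  rw [Set.ncard_coe_finset] at h2
  exact_mod_cast h1.trans h2

lemma mincard_le_NW {k : ℕ} {F : Set (ℕ → Fin k)} (hF : F.Nonempty)
    {U : Set ((ℕ → Fin k) × (ℕ → Fin k))} {N : ℕ}
    (hN : ∀ x y : ℕ → Fin k, (∀ i < N, x i = y i) → (x, y) ∈ U) (n : ℕ) :
    coverMincard shiftF F U n ≤ ((NW (N + n) F : ℕ) : ℕ∞) := by
  classical
  have hfin : (res (N + n) '' F).Finite := Set.toFinite _
  have hch : ∀ p : Fin (N + n) → Fin k, p ∈ res (N + n) '' F → ∃ x ∈ F, res (N + n) x = p :=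
    fun p hp => hp
  have : Nonempty (ℕ → Fin k) := ⟨hF.choose⟩
  choose! g hg using hch
  let s : Finset (ℕ → Fin k) := hfin.toFinset.image g
  have hs : IsDynCoverOf shiftF F U n (s : Set (ℕ → Fin k)) := by
    intro x hx
    have hm : res (N + n) x ∈ res (N + n) '' F := ⟨x, hx, rfl⟩
    refine ⟨g (res (N + n) x), ?_, ?_⟩
    · simp only [s, Finset.coe_image, Set.Finite.coe_toFinset]
      exact ⟨_, hm, rfl⟩
    · refine mem_dynEntourage.2 fun j hj => hN _ _ fun i hi => ?_
      rw [shiftF_iter, shiftF_iter]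
      exact (res_eq_iff.1 (hg _ hm).2 (j + i) (by omega)).symm
  refine hs.coverMincard_le_card.trans ?_
  have : s.card ≤ NW (N + n) F := by
    refine Finset.card_image_le.trans ?_
    rw [NW, Set.ncard_eq_toFinset_card _ hfin]
  exact_mod_cast this

lemma adm_good {k : ℕ} {u v : ℕ → Fin k} (hA : Admissible u v) : ∃ h : ℝ,
    coverEntropy shiftF (SigmaUV u v) = (h : EReal) ∧
    GoodSeq k (fun j => ((v j : ℕ) : ℝ) - (u j : ℕ)) (fun n => (NW n (SigmaUV u v) : ℝ)) h := by
  set S := SigmaUV u v with hS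
  have hne : S.Nonempty := ⟨u, fun n => ⟨(hA n).1, (hA n).2.1⟩⟩
  have Zp : ∀ n, 0 < (NW n S : ℝ) := fun n => by exact_mod_cast NW_pos hne
  have Z1 : ∀ n, 1 ≤ (NW n S : ℝ) := fun n => by exact_mod_cast NW_pos hne
  have sub : Subadditive (fun n => Real.log (NW n S)) := by
    intro m n
    rw [← Real.log_mul (Zp m).ne' (Zp n).ne']
    refine Real.log_le_log (Zp _) ?_
    exact_mod_cast NW_submul u v m n
  have lognn : ∀ n, 0 ≤ Real.log (NW n S) := fun n => Real.log_nonneg (Z1 n)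
  have bdd : BddBelow (Set.range fun n : ℕ => Real.log (NW n S) / n) :=
    ⟨0, by rintro _ ⟨n, rfl⟩; exact div_nonneg (lognn n) (by positivity)⟩
  have lim := sub.tendsto_lim bdd
  set h := sub.lim with hh
  have h0 : 0 ≤ h := ge_of_tendsto lim
    (Filter.Eventually.of_forall fun n => div_nonneg (lognn n) (by positivity))
  have hlow : ∀ n : ℕ, h * n ≤ Real.log (NW n S) := by
    intro n
    rcases Nat.eq_zero_or_pos n with rfl | hn
    · simpa using lognn 0
    · have := sub.lim_le_div bdd hn.ne'
      rwa [le_div_iff₀ (by exact_mod_cast hn)] at this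
  have growth : ExpGrowth.expGrowthSup (fun n => ((NW n S : ℕ) : ENNReal)) = (h : EReal) := by
    refine Filter.Tendsto.limsup_eq ?_
    have : Filter.Tendsto (fun n : ℕ => ((Real.log (NW n S) / n : ℝ) : EReal)) Filter.atTop
        (nhds (h : EReal)) := (continuous_coe_real_ereal.tendsto _).comp lim
    refine this.congr fun n => ?_
    rw [EReal.coe_div]
    congr 1
    beta_reduce
    rw [ENNReal.log_pos_real (by exact_mod_cast (NW_pos hne).ne') (by simp)]
    simp
  refine ⟨h, le_antisymm ?_ ?_, ?_⟩
  · refine iSup₂_le fun U hU => ?_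
    obtain ⟨N, hN⟩ := exists_depth hU
    rw [← growth]
    refine ExpGrowth.expGrowthSup_le_of_eventually_le (b := ((NW N S : ℕ) : ENNReal)) (by simp)
      (Filter.Eventually.of_forall fun n => ?_)
    have h1 := (mincard_le_NW hne hN n).trans
      (Nat.cast_le.2 (NW_submul u v N n))
    have h2 := ENat.toENNReal_mono h1
    simpa using h2
  · refine le_trans ?_ (coverEntropyEntourage_le_coverEntropy shiftF S (mem_unif_zero k))
    rw [← growth]
    refine ExpGrowth.expGrowthSup_monotone fun n => ?_
    have := ENat.toENNReal_mono (NW_le_mincard S n)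
    simpa using this
  · refine ⟨fun j => ?_, fun n => (Zp n).le, ?_, NW_renewal hA, h0, ?_, fun n => ?_, ?_⟩
    · have h1 : ((v j : ℕ) : ℝ) ≤ k := by exact_mod_cast (v j).2.le
      have h2 : ((u j : ℕ) : ℝ) ≤ k := by exact_mod_cast (u j).2.le
      have h3 : (0 : ℝ) ≤ ((v j : ℕ) : ℝ) := by positivity
      have h4 : (0 : ℝ) ≤ ((u j : ℕ) : ℝ) := by positivity
      rw [abs_le]
      constructor <;> linarith
    · exact_mod_cast NW_zero hne
    · have h1 := hlow 1
      have h2 : (NW 1 S : ℝ) ≤ k := by exact_mod_cast (NW_le_pow (n := 1) S).trans (by simp)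
      have h3 := Real.log_le_sub_one_of_pos (Zp 1)
      simp at h1
      linarith
    · exact (Real.le_log_iff_exp_le (Zp n)).1 (hlow n)
    · intro t t0 t1
      rcases t0.eq_or_lt with rfl | tp
      · refine summable_of_ne_finset_zero (s := {0}) fun n hn => ?_
        simp at hn
        simp [hn]
      have hlt : h < -Real.log t := by
        have := (Real.log_lt_log tp t1)
        rw [Real.log_exp] at this
        linarith
      obtain ⟨c, hc1, hc2⟩ := exists_between hlt
      have q1 : t * Real.exp c < 1 := by
        calc t * Real.exp c < t * Real.exp (-Real.log t) :=
              mul_lt_mul_of_pos_left (Real.exp_lt_exp.2 hc2) tp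
          _ = 1 := by rw [Real.exp_neg, Real.exp_log tp, mul_inv_cancel₀ tp.ne']
      refine summable_of_isBigO_nat (summable_geometric_of_lt_one (by positivity) q1) ?_
      refine Asymptotics.IsBigO.of_bound 1 ?_
      filter_upwards [lim.eventually_lt_const hc1, Filter.eventually_gt_atTop 0] with n hn hn0
      have hn0' : (0 : ℝ) < n := by exact_mod_cast hn0
      rw [div_lt_iff₀ hn0'] at hn
      have := (Real.log_le_iff_le_exp (Zp n)).1 hn.le
      rw [Real.norm_of_nonneg (mul_nonneg (Zp n).le (by positivity)),
        Real.norm_of_nonneg (by positivity), one_mul, mul_pow, ← Real.exp_nat_mul,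
        mul_comm (n : ℝ) c, mul_comm (t ^ n)]
      exact mul_le_mul_of_nonneg_right this (by positivity)

/-- Continuity of the topological entropy of `Σ_{u,v}` in the critical orbits `(u,v)`:
for every `δ > 0` there is `L` such that whenever two admissible pairs agree on their
first `L` coordinates, the entropies differ by at most `δ`. -/
theorem coverEntropy_SigmaUV_continuous (k : ℕ) (hk : 2 ≤ k) (δ : ℝ) (hδ : 0 < δ) :
    ∃ L : ℕ, ∀ u v u' v' : ℕ → Fin k,
      Admissible u v → Admissible u' v' →
      (∀ i < L, u i = u' i) → (∀ i < L, v i = v' i) →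
      coverEntropy shiftF (SigmaUV u' v') ≤ coverEntropy shiftF (SigmaUV u v) + (δ : EReal) ∧
      coverEntropy shiftF (SigmaUV u v) ≤ coverEntropy shiftF (SigmaUV u' v') + (δ : EReal) := by
  obtain ⟨L, hL⟩ := goodSeq_cont k δ hδ
  refine ⟨L, fun u v u' v' hA hA' hu hv => ?_⟩
  obtain ⟨h, e, g⟩ := adm_good hA
  obtain ⟨h', e', g'⟩ := adm_good hA'
  have ag : ∀ i < L, ((v i : ℕ) : ℝ) - (u i : ℕ) = ((v' i : ℕ) : ℝ) - (u' i : ℕ) :=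
    fun i hi => by rw [hu i hi, hv i hi]
  rw [e, e', ← EReal.coe_add, ← EReal.coe_add, EReal.coe_le_coe_iff, EReal.coe_le_coe_iff]
  exact ⟨hL _ _ _ _ _ _ g g' ag, hL _ _ _ _ _ _ g' g fun i hi => (ag i hi).symm⟩
end

section
/- Let u ∈ ℕ^ℕ be a sequence for which there exists (α,β) ∈ [0,1)×(1,∞) with i^{α,β}(0) = u, and define α_u(β) := (β−1)·Σ_{j≥0} u_j·β^{-(j+1)} for β > 1. Then there exists β_u ≥ 1 such that {(α,β) ∈ [0,1)×(1,∞) : i^{α,β}(0) = u} = {(α_u(β), β) : β ∈ I_u}, where I_u is either the open interval (β_u,∞) or the half-open interval [β_u,∞). -/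
open MeasureTheory Filter

/-- The map `x ↦ β·x + α mod 1` (fractional part of `β·x + α`). -/
noncomputable def Tab (α β : ℝ) (x : ℝ) : ℝ := Int.fract (β * x + α)

/-- The coding sequence of `x` under `T_{α,β}`: `i^{α,β}_n(x) = ⌊β·T^n(x) + α⌋`. -/
noncomputable def code (α β : ℝ) (x : ℝ) : ℕ → ℕ :=
  fun n => (⌊β * (Tab α β)^[n] x + α⌋).toNat

/-- Unnormalized Parry density. -/
noncomputable def parryG (α β : ℝ) (x : ℝ) : ℝ :=
  ∑' n : ℕ, ((if x < (Tab α β)^[n] 1 then (1 : ℝ) else 0)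
    - (if x < (Tab α β)^[n] 0 then (1 : ℝ) else 0)) / β ^ (n + 1)

/-- Normalization constant. -/
noncomputable def parryN (α β : ℝ) : ℝ := ∫ x in Set.Icc (0 : ℝ) 1, parryG α β x

/-- The Parry measure `μ_{α,β}`, absolutely continuous w.r.t. Lebesgue on `[0,1]`. -/
noncomputable def parryMeasure (α β : ℝ) : Measure ℝ :=
  (volume.restrict (Set.Icc (0 : ℝ) 1)).withDensity
    (fun x => ENNReal.ofReal (parryG α β x / parryN α β))

/-- The orbit of `x` under `T` is `μ`-normal. -/
def IsNormalOrbit (T : ℝ → ℝ) (μ : Measure ℝ) (x : ℝ) : Prop :=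
  ∀ f : ℝ → ℝ, ContinuousOn f (Set.Icc 0 1) →
    Tendsto (fun n : ℕ => (n : ℝ)⁻¹ * ∑ m ∈ Finset.range n, f (T^[m] x)) atTop
      (nhds (∫ y, f y ∂μ))

/-- Left shift on `ℕ^ℕ`. -/
def shiftN (y : ℕ → ℕ) : ℕ → ℕ := fun n => y (n + 1)


/-- digit -/
noncomputable def dg (α β x : ℝ) : ℝ := (⌊β * x + α⌋ : ℝ)

/-- counting operator -/
noncomputable def Aop (α β : ℝ) (p : ℝ → ℝ) : ℝ → ℝ :=
  fun x => dg α β x * (p 1 - p 0) + p (Tab α β x)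

/-- mass -/
noncomputable def Pm (α β : ℝ) (n : ℕ) (p : ℝ → ℝ) : ℝ :=
  (Aop α β)^[n] p 1 - (Aop α β)^[n] p 0

/-- end indicator -/
noncomputable def eI : ℝ → ℝ := fun x => if 1 ≤ x then 1 else 0

lemma Tab_mem (α β x : ℝ) : Tab α β x ∈ Set.Ico (0:ℝ) 1 :=
  ⟨Int.fract_nonneg _, Int.fract_lt_one _⟩

lemma Tab_mem' (α β x : ℝ) : Tab α β x ∈ Set.Icc (0:ℝ) 1 :=
  ⟨Int.fract_nonneg _, (Int.fract_lt_one _).le⟩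

lemma Tab_eq (α β x : ℝ) : Tab α β x = β * x + α - dg α β x := rfl

lemma Aop_mono {α β : ℝ} (hβ : 1 < β) {p : ℝ → ℝ} (hp : MonotoneOn p (Set.Icc 0 1)) :
    MonotoneOn (Aop α β p) (Set.Icc 0 1) := by
  intro x hx y hy hxy
  have h01 : p 0 ≤ p 1 := hp (by simp) (by simp) zero_le_one
  have hle : β * x + α ≤ β * y + α := by nlinarith
  have hfl : ⌊β * x + α⌋ ≤ ⌊β * y + α⌋ := Int.floor_le_floor hle
  unfold Aop
  rcases hfl.eq_or_lt with h | h
  · have hd : dg α β x = dg α β y := by simp [dg, h]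
    have : Tab α β x ≤ Tab α β y := by rw [Tab_eq, Tab_eq, hd]; linarith
    have := hp (Tab_mem' α β x) (Tab_mem' α β y) this
    rw [hd]; linarith
  · have hd : dg α β x + 1 ≤ dg α β y := by
      unfold dg; exact_mod_cast h
    have h1 := hp (Tab_mem' α β x) (by simp : (1:ℝ) ∈ Set.Icc (0:ℝ) 1) (Tab_mem' α β x).2
    have h2 := hp (by simp : (0:ℝ) ∈ Set.Icc (0:ℝ) 1) (Tab_mem' α β y) (Tab_mem' α β y).1
    nlinarith

lemma Aop_iter_mono {α β : ℝ} (hβ : 1 < β) (n : ℕ) {p : ℝ → ℝ}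
    (hp : MonotoneOn p (Set.Icc 0 1)) :
    MonotoneOn ((Aop α β)^[n] p) (Set.Icc 0 1) := by
  induction n with
  | zero => simpa
  | succ n ih => rw [Function.iterate_succ_apply']; exact Aop_mono hβ ih

lemma Pm_nonneg {α β : ℝ} (hβ : 1 < β) (n : ℕ) {p : ℝ → ℝ}
    (hp : MonotoneOn p (Set.Icc 0 1)) : 0 ≤ Pm α β n p :=
  sub_nonneg.2 (Aop_iter_mono hβ n hp (by simp) (by simp) zero_le_one)

lemma Aop_iter_lin (α β : ℝ) (n : ℕ) (c : ℝ) (p q : ℝ → ℝ) :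
    (Aop α β)^[n] (fun x => c * p x + q x) =
      fun x => c * (Aop α β)^[n] p x + (Aop α β)^[n] q x := by
  induction n with
  | zero => simp
  | succ n ih =>
    simp only [Function.iterate_succ_apply', ih]
    funext x
    simp only [Aop]
    ring

lemma Pm_lin (α β : ℝ) (n : ℕ) (c : ℝ) (p q : ℝ → ℝ) :
    Pm α β n (fun x => c * p x + q x) = c * Pm α β n p + Pm α β n q := by
  simp only [Pm, Aop_iter_lin]; ring

lemma Pm_id (α β : ℝ) (n : ℕ) : Pm α β n (fun x => x) = β ^ n := by
  have : ∃ b : ℝ, (Aop α β)^[n] (fun x => x) = fun x => β ^ n * x + b := by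
    induction n with
    | zero => exact ⟨0, by simp⟩
    | succ n ih =>
      obtain ⟨b, hb⟩ := ih
      refine ⟨β ^ n * α + b, ?_⟩
      rw [Function.iterate_succ_apply', hb]
      funext x
      simp only [Aop, Tab_eq]
      ring
  obtain ⟨b, hb⟩ := this
  simp [Pm, hb]

lemma eI_mono : Monotone eI := by
  intro x y h
  unfold eI
  split_ifs <;> first | linarith | norm_num

lemma eI_one : eI 1 = 1 := by norm_num [eI]

lemma eI_zero : eI 0 = 0 := by norm_num [eI]

lemma eI_Tab (α β x : ℝ) : eI (Tab α β x) = 0 := by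
  simp [eI, (Tab_mem α β x).2]

lemma Pm_zero (α β : ℝ) (p : ℝ → ℝ) : Pm α β 0 p = p 1 - p 0 := rfl

lemma Pm_succ (α β : ℝ) (n : ℕ) (p : ℝ → ℝ) :
    Pm α β (n+1) p = (p 1 - p 0) * Pm α β (n+1) eI + Pm α β n (fun x => p (Tab α β x)) := by
  have h1 : Aop α β p = fun x => (p 1 - p 0) * Aop α β eI x + p (Tab α β x) := by
    funext x
    simp only [Aop, eI_Tab, eI_one, eI_zero]
    ring
  have : Pm α β (n+1) p = Pm α β n (Aop α β p) := by simp [Pm]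
  rw [this, h1, Pm_lin]
  simp [Pm]

lemma Pm_expand (α β : ℝ) (n : ℕ) (p : ℝ → ℝ) :
    Pm α β n p = ∑ j ∈ Finset.range (n+1),
      (p ((Tab α β)^[j] 1) - p ((Tab α β)^[j] 0)) * Pm α β (n-j) eI := by
  induction n generalizing p with
  | zero => simp [Pm_zero, eI_one, eI_zero]
  | succ n ih =>
    rw [Pm_succ, ih, Finset.sum_range_succ' _ (n+1), add_comm]
    simp only [← Function.iterate_succ_apply', Nat.add_sub_add_right, Function.iterate_zero, id,
      Nat.sub_zero, Nat.succ_eq_add_one]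

lemma exists_a (α β : ℝ) (J : ℕ) : ∃ a : ℝ, 0 ≤ a ∧ a < 1 ∧ ∀ j < J,
    (Tab α β)^[j+1] 1 ≤ a ∧ (Tab α β)^[j+1] 0 ≤ a := by
  induction J with
  | zero => exact ⟨0, le_rfl, by norm_num, by simp⟩
  | succ J ih =>
    obtain ⟨a, h0, h1, h⟩ := ih
    refine ⟨max a (max ((Tab α β)^[J+1] 1) ((Tab α β)^[J+1] 0)), by simp [h0], ?_, ?_⟩
    · simp only [max_lt_iff]
      refine ⟨h1, ?_, ?_⟩ <;> rw [Function.iterate_succ_apply'] <;> exact (Tab_mem _ _ _).2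
    · intro j hj
      rcases Nat.lt_succ_iff_lt_or_eq.1 hj with hj | rfl
      · exact ⟨le_max_of_le_left (h j hj).1, le_max_of_le_left (h j hj).2⟩
      · simp

lemma iter_mem_s8 (α β : ℝ) (n : ℕ) {x : ℝ} (hx : x ∈ Set.Icc (0:ℝ) 1) :
    (Tab α β)^[n] x ∈ Set.Icc (0:ℝ) 1 := by
  cases n with
  | zero => simpa
  | succ n => rw [Function.iterate_succ_apply']; exact Tab_mem' _ _ _

lemma c_rec {α β : ℝ} (hβ : 1 < β) (J : ℕ) : ∃ K : ℝ, 0 < K ∧ ∀ n,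
    Pm α β n eI ≤ K * β ^ n + ∑ m ∈ Finset.range (n - J), Pm α β m eI := by
  obtain ⟨a, h0, h1, h⟩ := exists_a α β J
  have ha : 0 < 1 - a := by linarith
  refine ⟨(1-a)⁻¹, by positivity, fun n => ?_⟩
  set p : ℝ → ℝ := fun z => max (z - a) 0 with hp
  have hpm : Monotone p := fun x y hxy => max_le_max (by linarith) le_rfl
  have hqm : Monotone (fun z : ℝ => min z a) := fun x y hxy => min_le_min hxy le_rfl
  have hid : (fun x : ℝ => x) = fun x => 1 * p x + min x a := by
    funext x
    simp only [hp]
    rcases le_total x a with h | h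
    · rw [max_eq_right (by linarith), min_eq_left h]; ring
    · rw [max_eq_left (by linarith), min_eq_right h]; ring
  have hP : Pm α β n p ≤ β ^ n := by
    have h1 := Pm_id α β n
    rw [hid, Pm_lin] at h1
    have := Pm_nonneg (α := α) hβ n (hqm.monotoneOn (Set.Icc 0 1))
    linarith
  have hc : ∀ m, 0 ≤ Pm α β m eI := fun m => Pm_nonneg hβ m (eI_mono.monotoneOn _)
  have hrange : ∀ z ∈ Set.Icc (0:ℝ) 1, 0 ≤ p z ∧ p z ≤ 1 - a := by
    intro z hz
    exact ⟨le_max_right _ _, max_le (by linarith [hz.2]) ha.le⟩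
  have hp1 : p 1 = 1 - a := max_eq_left ha.le
  have hp0 : p 0 = 0 := max_eq_right (by linarith)
  have key : (1-a) * (Pm α β n eI - ∑ m ∈ Finset.range (n - J), Pm α β m eI) ≤ Pm α β n p := by
    rw [Pm_expand α β n p, Finset.sum_range_succ']
    simp only [Function.iterate_zero, id, hp1, hp0, Nat.sub_zero]
    have hs : ∑ m ∈ Finset.range (n - J), Pm α β m eI
        = ∑ j ∈ Finset.range n, if J ≤ j then Pm α β (n - (j+1)) eI else 0 := by
      rw [← Finset.sum_filter]
      refine Finset.sum_bij' (fun m _ => n - (m+1)) (fun j _ => n - (j+1)) ?_ ?_ ?_ ?_ ?_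
      · intro m hm; simp at hm ⊢; omega
      · intro m hm; simp at hm ⊢; omega
      · intro m hm; simp at hm ⊢; omega
      · intro m hm; simp at hm ⊢; omega
      · intro m hm
        simp at hm
        congr 1
        omega
    rw [mul_sub, hs, Finset.mul_sum]
    have : ∑ j ∈ Finset.range n, -((1-a) * (if J ≤ j then Pm α β (n - (j+1)) eI else 0)) ≤
        ∑ k ∈ Finset.range n, (p ((Tab α β)^[k+1] 1) - p ((Tab α β)^[k+1] 0)) *
          Pm α β (n-(k+1)) eI := by
      apply Finset.sum_le_sum
      intro j _
      have hcj := hc (n - (j+1))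
      split_ifs with hJ
      · have h1 := hrange _ (iter_mem_s8 α β (j+1) (by simp : (1:ℝ) ∈ Set.Icc (0:ℝ) 1))
        have h2 := hrange _ (iter_mem_s8 α β (j+1) (by simp : (0:ℝ) ∈ Set.Icc (0:ℝ) 1))
        nlinarith
      · have hj := h j (by omega)
        have e1 : p ((Tab α β)^[j+1] 1) = 0 := max_eq_right (by linarith [hj.1])
        have e2 : p ((Tab α β)^[j+1] 0) = 0 := max_eq_right (by linarith [hj.2])
        rw [e1, e2]; simp
    rw [Finset.sum_neg_distrib] at this
    linarith
  have := key.trans hP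
  rw [← sub_le_iff_le_add, inv_mul_eq_div, le_div_iff₀ ha]
  linarith

lemma c_bound {α β s : ℝ} (hβ : 1 < β) (hs : β < s) :
    ∃ K : ℝ, ∀ n, Pm α β n eI ≤ K * s ^ n := by
  have hs1 : 1 < s := hβ.trans hs
  obtain ⟨J, hJ⟩ : ∃ J : ℕ, 2 / (s - 1) < s ^ J := pow_unbounded_of_one_lt _ hs1
  obtain ⟨K, hK, h⟩ := c_rec (α := α) hβ J
  refine ⟨2 * K, fun n => ?_⟩
  induction n using Nat.strong_induction_on with
  | _ n ih =>
    have h1 := h n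
    have h2 : ∑ m ∈ Finset.range (n - J), Pm α β m eI ≤ K * s ^ n := by
      rcases le_or_gt n J with hn | hn
      · rw [Nat.sub_eq_zero_of_le hn]; simp; positivity
      calc _ ≤ ∑ m ∈ Finset.range (n - J), 2 * K * s ^ m :=
            Finset.sum_le_sum fun m hm => ih m (by simp at hm; omega)
        _ = 2 * K * ((s ^ (n - J) - 1) / (s - 1)) := by
            rw [← Finset.mul_sum, geom_sum_eq hs1.ne']
        _ ≤ K * s ^ n := by
            have hsp : 0 < s - 1 := by linarith
            rw [div_lt_iff₀ hsp] at hJ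
            have e : s ^ n = s ^ (n - J) * s ^ J := by rw [← pow_add]; congr 1; omega
            rw [← mul_div_assoc, div_le_iff₀ hsp, e]
            have : 0 < s ^ (n-J) := by positivity
            have h3 := mul_lt_mul_of_pos_left hJ (mul_pos hK this)
            nlinarith
    have h3 : K * β ^ n ≤ K * s ^ n := by gcongr
    linarith

lemma ell (α β : ℝ) (n : ℕ) (x : ℝ) :
    (Aop α β)^[n+1] eI x - (Aop α β)^[n+1] eI 0 = ∑ j ∈ Finset.range (n+1),
      (dg α β ((Tab α β)^[j] x) - dg α β ((Tab α β)^[j] 0)) * Pm α β (n-j) eI := by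
  have gen : ∀ y : ℝ, (Aop α β)^[n+1] eI y = ∑ j ∈ Finset.range (n+1),
      dg α β ((Tab α β)^[j] y) * Pm α β (n-j) eI := by
    induction n with
    | zero => intro y; simp [Aop, eI_Tab, Pm]
    | succ n ih =>
      intro y
      rw [Function.iterate_succ_apply', Finset.sum_range_succ']
      unfold Aop
      simp only [Function.iterate_succ_apply]
      change dg α β y * Pm α β (n+1) eI + (Aop α β)^[n+1] eI (Tab α β y) = _
      rw [ih]
      simp [add_comm]
  rw [gen x, gen 0, ← Finset.sum_sub_distrib]
  exact Finset.sum_congr rfl fun j _ => by ring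

lemma h_range {α β β' x : ℝ} (hα : α ∈ Set.Ico (0:ℝ) 1) (hβ : 1 < β) (hs : β < β')
    (hx : x ∈ Set.Icc (0:ℝ) 1) :
    0 ≤ ∑' j : ℕ, (dg α β ((Tab α β)^[j] x) - dg α β ((Tab α β)^[j] 0)) / β' ^ (j+1) ∧
    ∑' j : ℕ, (dg α β ((Tab α β)^[j] x) - dg α β ((Tab α β)^[j] 0)) / β' ^ (j+1) < 1 := by
  obtain ⟨s, hs1, hs2⟩ := exists_between hs
  have hβ' : 1 < β' := hβ.trans hs
  have hs0 : 0 < s := by linarith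
  obtain ⟨K, hK⟩ := c_bound (α := α) hβ hs1
  have hc : ∀ m, 0 ≤ Pm α β m eI := fun m => Pm_nonneg hβ m (eI_mono.monotoneOn _)
  set t : ℝ := β'⁻¹ with ht
  have ht0 : 0 < t := by positivity
  have ht1 : t < 1 := inv_lt_one_of_one_lt₀ hβ'
  have hst : s * t < 1 := by rw [ht, ← div_eq_mul_inv, div_lt_one (by linarith)]; exact hs2
  have sumC : Summable fun n => Pm α β n eI * t ^ n := by
    refine Summable.of_nonneg_of_le (fun n => mul_nonneg (hc n) (by positivity))
      (fun n => ?_) ((summable_geometric_of_lt_one (by positivity) hst).mul_left K)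
    rw [mul_pow, ← mul_assoc]
    gcongr
    exact hK n
  set b : ℕ → ℝ := fun j => dg α β ((Tab α β)^[j] x) - dg α β ((Tab α β)^[j] 0) with hb
  have hdg : ∀ z ∈ Set.Icc (0:ℝ) 1, 0 ≤ dg α β z ∧ dg α β z ≤ β + 1 := by
    intro z hz
    have h0 : 0 ≤ β * z := mul_nonneg (by linarith) hz.1
    constructor
    · unfold dg
      exact_mod_cast Int.floor_nonneg.2 (by linarith [hα.1])
    · refine (Int.floor_le _).trans ?_
      nlinarith [hz.2, hα.2]
  have sumB : Summable fun j => ‖b j * t ^ j‖ := by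
    refine Summable.of_nonneg_of_le (fun n => norm_nonneg _)
      (fun n => ?_) ((summable_geometric_of_lt_one ht0.le ht1).mul_left (β+1))
    rw [norm_mul, Real.norm_eq_abs, Real.norm_of_nonneg (by positivity : 0 ≤ t ^ n)]
    gcongr
    have h1 := hdg _ (iter_mem_s8 α β n hx)
    have h2 := hdg _ (iter_mem_s8 α β n (by simp : (0:ℝ) ∈ Set.Icc (0:ℝ) 1))
    rw [abs_le]
    constructor <;> simp only [hb] <;> linarith
  have sumCn : Summable fun n => ‖Pm α β n eI * t ^ n‖ := sumC.norm
  have cauchy := tsum_mul_tsum_eq_tsum_sum_range_of_summable_norm sumB sumCn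
  have sumL := (summable_norm_sum_mul_range_of_summable_norm sumB sumCn).of_norm
  have hterm : ∀ n, ∑ k ∈ Finset.range (n+1), b k * t ^ k * (Pm α β (n-k) eI * t ^ (n-k))
      = ((Aop α β)^[n+1] eI x - (Aop α β)^[n+1] eI 0) * t ^ n := by
    intro n
    rw [ell, Finset.sum_mul]
    refine Finset.sum_congr rfl fun j hj => ?_
    have : t ^ n = t ^ j * t ^ (n-j) := by
      rw [← pow_add]; congr 1; simp at hj; omega
    rw [this]; ring
  simp only [hterm] at cauchy sumL
  have hx0 : ∀ n, 0 ≤ (Aop α β)^[n+1] eI x - (Aop α β)^[n+1] eI 0 := fun n =>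
    sub_nonneg.2 (Aop_iter_mono hβ _ (eI_mono.monotoneOn _) (by simp) hx hx.1)
  have hx1 : ∀ n, (Aop α β)^[n+1] eI x - (Aop α β)^[n+1] eI 0 ≤ Pm α β (n+1) eI := fun n =>
    sub_le_sub_right (Aop_iter_mono hβ _ (eI_mono.monotoneOn _) hx (by simp) hx.2) _
  have hC : ∑' n, Pm α β n eI * t ^ n = 1 + ∑' n, Pm α β (n+1) eI * t ^ (n+1) := by
    rw [sumC.tsum_eq_zero_add]
    simp [Pm_zero, eI_one, eI_zero]
  have hrest : 0 ≤ ∑' n, Pm α β (n+1) eI * t ^ (n+1) :=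
    tsum_nonneg fun n => mul_nonneg (hc _) (by positivity)
  have hgoal : ∑' j : ℕ, b j / β' ^ (j+1) = t * ∑' j, b j * t ^ j := by
    rw [← tsum_mul_left]
    refine tsum_congr fun j => ?_
    rw [ht, inv_pow, pow_succ]
    field_simp
  rw [hgoal]
  set B := ∑' j, b j * t ^ j
  set C := ∑' n, Pm α β n eI * t ^ n
  have hCpos : 0 < C := by linarith
  have h1 : 0 ≤ B * C := by
    rw [cauchy]
    exact tsum_nonneg fun n => mul_nonneg (hx0 n) (by positivity)
  have h2 : t * (B * C) ≤ C - 1 := by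
    rw [cauchy, hC, add_sub_cancel_left, ← tsum_mul_left]
    refine Summable.tsum_le_tsum (fun n => ?_) (sumL.mul_left t) ((summable_nat_add_iff 1).2 sumC)
    calc _ = ((Aop α β)^[n+1] eI x - (Aop α β)^[n+1] eI 0) * t ^ (n+1) := by ring
      _ ≤ _ := by gcongr; exact hx1 n
  constructor
  · exact mul_nonneg ht0.le (nonneg_of_mul_nonneg_left h1 hCpos)
  · by_contra hcon
    push Not at hcon
    nlinarith

lemma code_cast {α β : ℝ} (hα : α ∈ Set.Ico (0:ℝ) 1) (hβ : 1 < β) (n : ℕ) :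
    (code α β 0 n : ℝ) = dg α β ((Tab α β)^[n] 0) := by
  have h0 := (iter_mem_s8 α β n (by simp : (0:ℝ) ∈ Set.Icc (0:ℝ) 1)).1
  have : 0 ≤ ⌊β * (Tab α β)^[n] 0 + α⌋ :=
    Int.floor_nonneg.2 (by nlinarith [hα.1])
  unfold code dg
  rw [← Int.cast_natCast, Int.toNat_of_nonneg this]

lemma alpha_eq {α β : ℝ} (hα : α ∈ Set.Ico (0:ℝ) 1) (hβ : 1 < β) :
    α = (β - 1) * ∑' j : ℕ, (code α β 0 j : ℝ) / β ^ (j+1) := by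
  set y : ℕ → ℝ := fun k => ((Tab α β)^[k] 0 + α / (β - 1)) / β ^ k with hy
  have hb1 : β - 1 ≠ 0 := by linarith
  have hb0 : 0 < β := by linarith
  have hterm : ∀ j, (code α β 0 j : ℝ) / β ^ (j+1) = y j - y (j+1) := by
    intro j
    rw [code_cast hα hβ]
    simp only [hy, Function.iterate_succ_apply', Tab_eq]
    field_simp
    ring
  have hlim : Tendsto y atTop (nhds 0) := by
    have hA : 0 ≤ α / (β - 1) := div_nonneg hα.1 (by linarith)
    have hg : Tendsto (fun k : ℕ => (1 + α / (β-1)) * (β⁻¹) ^ k) atTop (nhds 0) := by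
      simpa using (tendsto_pow_atTop_nhds_zero_of_lt_one (by positivity)
        (inv_lt_one_of_one_lt₀ hβ)).const_mul (1 + α / (β-1))
    refine squeeze_zero (fun k => ?_) (fun k => ?_) hg
    · have h0 := (iter_mem_s8 α β k (by simp : (0:ℝ) ∈ Set.Icc (0:ℝ) 1)).1
      positivity
    · have h0 := (iter_mem_s8 α β k (by simp : (0:ℝ) ∈ Set.Icc (0:ℝ) 1)).2
      simp only [hy, div_eq_mul_inv _ (β ^ k), inv_pow]
      gcongr
  have hsum : HasSum (fun j => (code α β 0 j : ℝ) / β ^ (j+1)) (y 0) := by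
    rw [hasSum_iff_tendsto_nat_of_nonneg (fun j => by positivity)]
    simp only [hterm, Finset.sum_range_sub']
    simpa using hlim.const_sub (y 0)
  rw [hsum.tsum_eq]
  simp [hy]
  field_simp

lemma code_le {α β : ℝ} (hα : α ∈ Set.Ico (0:ℝ) 1) (hβ : 1 < β) (n : ℕ) :
    (code α β 0 n : ℝ) ≤ β + 1 := by
  rw [code_cast hα hβ]
  have h0 := (iter_mem_s8 α β n (by simp : (0:ℝ) ∈ Set.Icc (0:ℝ) 1))
  refine (Int.floor_le _).trans ?_
  nlinarith [h0.2, hα.2]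

lemma up_closed {α β β' : ℝ} (hα : α ∈ Set.Ico (0:ℝ) 1) (hβ : 1 < β) (hs : β < β') (u : ℕ → ℕ)
    (hu : code α β 0 = u) :
    ((β' - 1) * ∑' j : ℕ, (u j : ℝ) / β' ^ (j + 1)) ∈ Set.Ico (0:ℝ) 1 ∧
    code ((β' - 1) * ∑' j : ℕ, (u j : ℝ) / β' ^ (j + 1)) β' 0 = u := by
  have hβ' : 1 < β' := hβ.trans hs
  have hb0 : 0 < β' := by linarith
  set U : ℕ → ℝ := fun k => ∑' j : ℕ, (u (k + j) : ℝ) / β' ^ (j + 1) with hU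
  have hsumU : ∀ k, Summable fun j : ℕ => (u (k + j) : ℝ) / β' ^ (j + 1) := by
    intro k
    refine Summable.of_nonneg_of_le (fun n => by positivity) (fun n => ?_)
      ((summable_geometric_of_lt_one (inv_pos.2 hb0).le
        (inv_lt_one_of_one_lt₀ hβ')).mul_left ((β+1) * β'⁻¹))
    have := code_le hα hβ (k+n)
    rw [hu] at this
    rw [div_eq_mul_inv, mul_assoc, ← pow_succ', ← inv_pow]
    gcongr
  have hUrec : ∀ k, U (k+1) = β' * U k - u k := by
    intro k
    have : U k = u k / β' + U (k+1) / β' := by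
      simp only [hU]
      rw [(hsumU k).tsum_eq_zero_add, ← tsum_div_const]
      simp only [add_zero, zero_add, pow_one]
      congr 1
      refine tsum_congr fun j => ?_
      rw [pow_succ _ (j+1), div_div, show k + (j+1) = k+1+j by ring]
    rw [this]; field_simp; ring
  have hU0 : ∑' j : ℕ, (u j : ℝ) / β' ^ (j + 1) = U 0 := by simp [hU]
  rw [hU0]
  set α' := (β' - 1) * U 0 with hα'
  set x : ℕ → ℝ := fun k => U k - U 0 with hxdef
  have hxrange : ∀ k, 0 ≤ x k ∧ x k < 1 := by
    intro k
    have := h_range hα hβ hs (iter_mem_s8 α β k (by simp : (0:ℝ) ∈ Set.Icc (0:ℝ) 1))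
    have e : x k = ∑' j : ℕ, (dg α β ((Tab α β)^[j] ((Tab α β)^[k] 0))
        - dg α β ((Tab α β)^[j] 0)) / β' ^ (j+1) := by
      simp only [hxdef, hU]
      rw [← (hsumU k).tsum_sub (hsumU 0)]
      refine tsum_congr fun j => ?_
      rw [← hu, code_cast hα hβ, code_cast hα hβ, ← Function.iterate_add_apply, zero_add,
        add_comm k j, sub_div]
    rw [e]; exact this
  have hxrec : ∀ k, x (k+1) = β' * x k + α' - u k := by
    intro k
    simp only [hxdef, hUrec, hα']; ring
  have hu0 : u 0 = 0 := by
    rw [← hu]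
    simp only [code, Function.iterate_zero, id, mul_zero, zero_add]
    rw [Int.floor_eq_zero_iff.2 hα]; rfl
  have hx0 : x 0 = 0 := by simp [hxdef]
  have hfl : ∀ k, ⌊β' * x k + α'⌋ = (u k : ℤ) := by
    intro k
    rw [Int.floor_eq_iff]
    have := hxrange (k+1)
    rw [hxrec] at this
    push_cast
    constructor <;> linarith
  have hT : ∀ k, (Tab α' β')^[k] 0 = x k := by
    intro k
    induction k with
    | zero => simp [hx0]
    | succ k ih =>
      rw [Function.iterate_succ_apply', ih, Tab_eq, hxrec, dg, hfl]
      simp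
  constructor
  · have := hxrange 1
    rw [hxrec, hx0, hu0] at this
    simpa using this
  · funext k
    simp [code, hT, hfl]

/-- The equivalence class `[u] = {(α,β) : i^{α,β}(0) = u}` is the graph of the analytic curve
`β ↦ α_u(β) = (β-1)·Σ_j u_j β^{-(j+1)}` over an interval `I_u = (β_u,∞)` or `[β_u,∞)` with
`β_u ≥ 1`. -/
theorem equivalence_class_is_curve (u : ℕ → ℕ)
    (hu : ∃ α β : ℝ, α ∈ Set.Ico (0 : ℝ) 1 ∧ 1 < β ∧ code α β 0 = u) :
    ∃ βu : ℝ, 1 ≤ βu ∧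
      ({p : ℝ × ℝ | p.1 ∈ Set.Ico (0 : ℝ) 1 ∧ 1 < p.2 ∧ code p.1 p.2 0 = u} =
          (fun β : ℝ => ((β - 1) * ∑' j : ℕ, (u j : ℝ) / β ^ (j + 1), β)) '' Set.Ioi βu ∨
        {p : ℝ × ℝ | p.1 ∈ Set.Ico (0 : ℝ) 1 ∧ 1 < p.2 ∧ code p.1 p.2 0 = u} =
          (fun β : ℝ => ((β - 1) * ∑' j : ℕ, (u j : ℝ) / β ^ (j + 1), β)) '' Set.Ici βu) := by
  set S : Set ℝ := {β | ∃ α, α ∈ Set.Ico (0 : ℝ) 1 ∧ 1 < β ∧ code α β 0 = u} with hS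
  have hne : S.Nonempty := by
    obtain ⟨α, β, h⟩ := hu
    exact ⟨β, α, h⟩
  have hlb : ∀ β ∈ S, 1 ≤ β := fun β ⟨_, _, h, _⟩ => h.le
  have hbdd : BddBelow S := ⟨1, hlb⟩
  have hup : ∀ β ∈ S, ∀ β', β < β' → β' ∈ S := by
    rintro β ⟨α, hα, hβ, h⟩ β' hs
    have := up_closed hα hβ hs u h
    exact ⟨_, this.1, hβ.trans hs, this.2⟩
  have himg : {p : ℝ × ℝ | p.1 ∈ Set.Ico (0 : ℝ) 1 ∧ 1 < p.2 ∧ code p.1 p.2 0 = u} =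
      (fun β : ℝ => ((β - 1) * ∑' j : ℕ, (u j : ℝ) / β ^ (j + 1), β)) '' S := by
    ext ⟨α, β⟩
    simp only [Set.mem_setOf_eq, Set.mem_image, Prod.mk.injEq]
    constructor
    · rintro ⟨hα, hβ, h⟩
      refine ⟨β, ⟨α, hα, hβ, h⟩, ?_, rfl⟩
      rw [← h]; exact (alpha_eq hα hβ).symm
    · rintro ⟨b, ⟨a, ha, hb, h⟩, h1, rfl⟩
      have := alpha_eq ha hb
      rw [h, h1] at this
      subst this
      exact ⟨ha, hb, h⟩
  have hIoi : Set.Ioi (sInf S) ⊆ S := by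
    intro b hb
    obtain ⟨c, hc, hcb⟩ := exists_lt_of_csInf_lt hne hb
    exact hup c hc b hcb
  refine ⟨sInf S, le_csInf hne hlb, ?_⟩
  rw [himg]
  by_cases hmem : sInf S ∈ S
  · right
    congr 1
    apply Set.Subset.antisymm
    · intro b hb; exact csInf_le hbdd hb
    · intro b hb
      rcases (Set.mem_Ici.1 hb).eq_or_lt with h | h
      · rw [← h]; exact hmem
      · exact hIoi h
  · left
    congr 1
    apply Set.Subset.antisymm
    · intro b hb
      refine lt_of_le_of_ne (csInf_le hbdd hb) ?_
      rintro h
      exact hmem (h ▸ hb)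
    · exact hIoi
end

section
/- Let β > 1 and α, α' ∈ [0,1). If the coding sequences of 0 coincide, i.e., i^{α,β}_n(0) = i^{α',β}_n(0) for all n ≥ 0, then α = α'. -/
open MeasureTheory Filter

/-- For fixed `β > 1`, the coding sequence of `0` determines `α`. -/
theorem alpha_eq_of_code_eq (β α α' : ℝ) (hβ : 1 < β) (hα : α ∈ Set.Ico (0 : ℝ) 1)
    (hα' : α' ∈ Set.Ico (0 : ℝ) 1) (h : ∀ n : ℕ, code α β 0 n = code α' β 0 n) :
    α = α' := by
  have hx : ∀ a : ℝ, a ∈ Set.Ico (0 : ℝ) 1 → ∀ n : ℕ,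
      0 ≤ (Tab a β)^[n] 0 ∧ (Tab a β)^[n] 0 < 1 := by
    intro a _ n
    cases n with
    | zero => simp
    | succ k =>
      rw [Function.iterate_succ_apply']
      exact ⟨Int.fract_nonneg _, Int.fract_lt_one _⟩
  have hc : ∀ a : ℝ, a ∈ Set.Ico (0 : ℝ) 1 → ∀ n : ℕ,
      (Tab a β)^[n + 1] 0 = β * (Tab a β)^[n] 0 + a - (code a β 0 n : ℝ) := by
    intro a ha n
    have h0 : 0 ≤ ⌊β * (Tab a β)^[n] 0 + a⌋ := by
      apply Int.floor_nonneg.mpr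
      have := mul_nonneg (by linarith : 0 ≤ β) (hx a ha n).1
      linarith [ha.1]
    have h1 : ((code a β 0 n : ℕ) : ℝ) = ((⌊β * (Tab a β)^[n] 0 + a⌋ : ℤ) : ℝ) := by
      have h2 : ((code a β 0 n : ℕ) : ℤ) = ⌊β * (Tab a β)^[n] 0 + a⌋ := Int.toNat_of_nonneg h0
      rw [← h2]
      simp
    rw [Function.iterate_succ_apply', h1]
    rfl
  have hd : ∀ n : ℕ, ∃ s : ℝ, (n : ℝ) ≤ s ∧
      (Tab α β)^[n] 0 - (Tab α' β)^[n] 0 = (α - α') * s := by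
    intro n
    induction n with
    | zero => exact ⟨0, by simp, by simp⟩
    | succ k ih =>
      obtain ⟨s, hs, e⟩ := ih
      have hk : (0 : ℝ) ≤ k := Nat.cast_nonneg k
      refine ⟨β * s + 1, by push_cast; nlinarith, ?_⟩
      rw [hc α hα, hc α' hα', h k]
      linear_combination β * e
  by_contra hne
  have hpos : 0 < |α - α'| := abs_pos.mpr (sub_ne_zero.mpr hne)
  obtain ⟨n, hn⟩ := exists_nat_gt (1 / |α - α'|)
  rw [div_lt_iff₀ hpos] at hn
  obtain ⟨s, hs, e⟩ := hd n
  have hb : |(α - α') * s| < 1 := by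
    rw [← e, abs_lt]
    constructor <;> linarith [(hx α hα n).1, (hx α hα n).2, (hx α' hα' n).1, (hx α' hα' n).2]
  rw [abs_mul] at hb
  nlinarith [le_abs_self s]
end

section
/- For all α ∈ [0,1), β > 1 and x ∈ [0,1), the φ-expansion identity holds: x = Σ_{j≥0} (i^{α,β}_j(x) − α)·β^{-(j+1)}, the series converging absolutely. In particular, applying this to x = 0 gives α = (β−1)·Σ_{j≥0} i^{α,β}_j(0)·β^{-(j+1)}. -/
open MeasureTheory Filter

theorem phi_aux (α β x : ℝ) (hα : α ∈ Set.Ico (0 : ℝ) 1) (hβ : 1 < β)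
    (hx : x ∈ Set.Ico (0 : ℝ) 1) :
    HasSum (fun j : ℕ => ((code α β x j : ℝ) - α) / β ^ (j + 1)) x := by
  have hβ0 : 0 < β := by linarith
  have ht : ∀ n, 0 ≤ (Tab α β)^[n] x ∧ (Tab α β)^[n] x < 1 := by
    intro n
    cases n with
    | zero => exact hx
    | succ n =>
      rw [Function.iterate_succ_apply']
      exact ⟨Int.fract_nonneg _, Int.fract_lt_one _⟩
  have hs : Summable (fun n : ℕ => (Tab α β)^[n] x / β ^ n) := by
    have hg : Summable (fun n : ℕ => (β⁻¹) ^ n) :=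
      summable_geometric_of_lt_one (by positivity) (inv_lt_one_of_one_lt₀ hβ)
    refine Summable.of_nonneg_of_le (fun n => div_nonneg (ht n).1 (by positivity))
      (fun n => ?_) hg
    rw [inv_pow, ← one_div]
    exact div_le_div_of_nonneg_right (ht n).2.le (by positivity)
  have hs1 := (summable_nat_add_iff 1).2 hs
  have h := hs.hasSum.sub hs1.hasSum
  rw [hs.tsum_eq_zero_add] at h
  simp only [Function.iterate_zero, id, pow_zero, div_one, add_sub_cancel_right] at h
  refine Eq.mp (congrArg (fun f : ℕ → ℝ => HasSum f x) ?_) h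
  symm
  funext j
  have hc : (code α β x j : ℝ) = β * (Tab α β)^[j] x + α - (Tab α β)^[j+1] x := by
    have h0 : 0 ≤ ⌊β * (Tab α β)^[j] x + α⌋ :=
      Int.floor_nonneg.2 (add_nonneg (mul_nonneg hβ0.le (ht j).1) hα.1)
    have h1 : (code α β x j : ℝ) = (⌊β * (Tab α β)^[j] x + α⌋ : ℝ) := by
      have : ((code α β x j : ℕ) : ℤ) = ⌊β * (Tab α β)^[j] x + α⌋ := Int.toNat_of_nonneg h0
      exact_mod_cast this
    rw [h1, Function.iterate_succ_apply']
    simp only [Tab, Int.fract]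
    ring
  rw [hc]
  field_simp
  ring

/-- The `φ`-expansion identity: `x = Σ_j (i^{α,β}_j(x) - α)/β^{j+1}` (the series converging
absolutely), and in particular `α = (β-1)·Σ_j i^{α,β}_j(0)/β^{j+1}`. -/
theorem phi_expansion (α β x : ℝ) (hα : α ∈ Set.Ico (0 : ℝ) 1) (hβ : 1 < β)
    (hx : x ∈ Set.Ico (0 : ℝ) 1) :
    Summable (fun j : ℕ => ((code α β x j : ℝ) - α) / β ^ (j + 1)) ∧
    x = ∑' j : ℕ, ((code α β x j : ℝ) - α) / β ^ (j + 1) ∧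
    α = (β - 1) * ∑' j : ℕ, (code α β 0 j : ℝ) / β ^ (j + 1) := by
  have h := phi_aux α β x hα hβ hx
  refine ⟨h.summable, h.tsum_eq.symm, ?_⟩
  have h0 := phi_aux α β 0 hα hβ ⟨le_rfl, one_pos⟩
  have hβ0 : 0 < β := by linarith
  have hb : β - 1 ≠ 0 := by linarith
  have hg := (hasSum_geometric_of_lt_one (r := β⁻¹) (by positivity)
    (inv_lt_one_of_one_lt₀ hβ)).mul_left (α / β)
  have hk := h0.add hg
  have he : (fun j : ℕ => (code α β 0 j : ℝ) / β ^ (j + 1)) =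
      fun j : ℕ => ((code α β 0 j : ℝ) - α) / β ^ (j + 1) + α / β * β⁻¹ ^ j := by
    funext j
    rw [inv_pow]
    field_simp
    ring
  rw [he, hk.tsum_eq]
  have : 1 - β⁻¹ = (β - 1) / β := by field_simp
  rw [this]
  field_simp
  ring
end

section
/- Let x ∈ [0,1) and α ∈ [0,1) with (x,α) ≠ (0,0), and let β₁, β₂ > 1. If the full coding sequences coincide, i.e., i^{α,β₁}_n(x) = i^{α,β₂}_n(x) for all n ≥ 0, then β₁ = β₂. In other words, for fixed x and α (not both zero), the map β ↦ i^{α,β}(x) is injective on (1,∞). -/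
open MeasureTheory Filter

theorem orbit_mem (α β x : ℝ) (hx : x ∈ Set.Ico (0 : ℝ) 1) (n : ℕ) :
    (Tab α β)^[n] x ∈ Set.Ico (0 : ℝ) 1 := by
  cases n with
  | zero => simpa using hx
  | succ n =>
    rw [Function.iterate_succ_apply']
    exact ⟨Int.fract_nonneg _, Int.fract_lt_one _⟩

theorem orbit_succ (α β x : ℝ) (hx : x ∈ Set.Ico (0 : ℝ) 1) (hα : 0 ≤ α) (hβ : 1 < β) (n : ℕ) :
    (Tab α β)^[n + 1] x = β * (Tab α β)^[n] x + α - (code α β x n : ℝ) := by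
  have h0 := (orbit_mem α β x hx n).1
  have h1 : 0 ≤ β * (Tab α β)^[n] x + α := by positivity
  have h2 : 0 ≤ ⌊β * (Tab α β)^[n] x + α⌋ := Int.floor_nonneg.2 h1
  have h3 : ((code α β x n : ℕ) : ℝ) = (⌊β * (Tab α β)^[n] x + α⌋ : ℝ) := by
    have : ((code α β x n : ℕ) : ℤ) = ⌊β * (Tab α β)^[n] x + α⌋ := by
      simp only [code]; exact Int.toNat_of_nonneg h2
    exact_mod_cast this
  rw [Function.iterate_succ_apply', h3]
  rfl

theorem not_lt_of_code_eq (x α : ℝ) (hx : x ∈ Set.Ico (0 : ℝ) 1)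
    (hα : α ∈ Set.Ico (0 : ℝ) 1) (hxα : (x, α) ≠ (0, 0)) (β₁ β₂ : ℝ)
    (hβ₁ : 1 < β₁) (hβ₂ : 1 < β₂) (h : ∀ n : ℕ, code α β₁ x n = code α β₂ x n) :
    ¬ β₁ < β₂ := by
  intro hlt
  obtain ⟨d, hd⟩ : ∃ d : ℕ → ℝ, ∀ n, d n = (Tab α β₂)^[n] x - (Tab α β₁)^[n] x :=
    ⟨_, fun _ => rfl⟩
  have hrec : ∀ n, d (n + 1) = β₂ * d n + (β₂ - β₁) * (Tab α β₁)^[n] x := by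
    intro n
    rw [hd, hd, orbit_succ α β₂ x hx hα.1 hβ₂, orbit_succ α β₁ x hx hα.1 hβ₁, h n]
    ring
  have hge : ∀ n, β₂ * d n ≤ d (n + 1) := by
    intro n
    have := mul_nonneg (sub_nonneg.2 hlt.le) (orbit_mem α β₁ x hx n).1
    rw [hrec]; linarith
  have h0 : d 0 = 0 := by rw [hd]; simp
  have hpos : ∃ m, 0 < d m := by
    have e1 : d 1 = (β₂ - β₁) * x := by
      have := hrec 0
      rw [h0] at this
      simpa using this
    rcases hx.1.lt_or_eq with hx0 | hx0
    · exact ⟨1, by rw [e1]; exact mul_pos (sub_pos.2 hlt) hx0⟩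
    · subst hx0
      have hα0 : 0 < α := by
        rcases hα.1.lt_or_eq with h' | h'
        · exact h'
        · subst h'; exact absurd rfl hxα
      have e2 := hrec 1
      have e3 : (Tab α β₁)^[1] 0 = α := by
        simp [Tab, Int.fract_eq_self.2 ⟨hα.1, hα.2⟩]
      rw [e1, e3] at e2
      refine ⟨2, ?_⟩
      rw [e2]
      have := mul_pos (sub_pos.2 hlt) hα0
      linarith
  obtain ⟨m, hm⟩ := hpos
  have hgrow : ∀ k, β₂ ^ k * d m ≤ d (m + k) := by
    intro k
    induction k with
    | zero => simp
    | succ k ih =>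
      have h1 := hge (m + k)
      have h2 := mul_le_mul_of_nonneg_left ih (by linarith : (0 : ℝ) ≤ β₂)
      rw [pow_succ, ← add_assoc]
      linarith
  obtain ⟨k, hk⟩ := pow_unbounded_of_one_lt (1 / d m) hβ₂
  have h1 := hgrow k
  have h2 : 1 < β₂ ^ k * d m := (div_lt_iff₀ hm).1 hk
  have h3 := (orbit_mem α β₂ x hx (m + k)).2
  have h4 := (orbit_mem α β₁ x hx (m + k)).1
  rw [hd (m + k)] at h1
  linarith

/-- For fixed `x, α ∈ [0,1)` not both zero, the map `β ↦ i^{α,β}(x)` is injective on `(1,∞)`. -/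
theorem beta_eq_of_code_eq (x α : ℝ) (hx : x ∈ Set.Ico (0 : ℝ) 1)
    (hα : α ∈ Set.Ico (0 : ℝ) 1) (hxα : (x, α) ≠ (0, 0)) (β₁ β₂ : ℝ)
    (hβ₁ : 1 < β₁) (hβ₂ : 1 < β₂) (h : ∀ n : ℕ, code α β₁ x n = code α β₂ x n) :
    β₁ = β₂ := by
  rcases lt_trichotomy β₁ β₂ with hl | he | hl
  · exact absurd hl (not_lt_of_code_eq x α hx hα hxα β₁ β₂ hβ₁ hβ₂ h)
  · exact he
  · exact absurd hl (not_lt_of_code_eq x α hx hα hxα β₂ β₁ hβ₂ hβ₁ (fun n => (h n).symm))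
end

section
/- Let α ∈ [0,1), β > 1, and let u = i^{α,β}(0) be the coding sequence of 0 under T_{α,β}. Then for every β' ≥ β, setting α' := (β'−1)·Σ_{j≥0} u_j·β'^{-(j+1)}, one has α' ∈ [0,1), α' ≤ α, and i^{α',β'}(0) = u. -/
open MeasureTheory Filter

namespace CKC

noncomputable def V (l : ℝ) (a : ℕ → ℝ) (n : ℕ) : ℝ := ∑' j : ℕ, a (n + j) / l ^ (j + 1)

def Bd (a : ℕ → ℝ) : Prop := ∃ C : ℝ, ∀ m, |a m| ≤ C

lemma hasSum_geo {l : ℝ} (hl : 1 < l) : HasSum (fun j : ℕ => 1 / l ^ (j + 1)) (1 / (l - 1)) := by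
  have h := (hasSum_geometric_of_lt_one (r := l⁻¹) (by positivity) (inv_lt_one_of_one_lt₀ hl)).mul_left l⁻¹
  have e : l⁻¹ * (1 - l⁻¹)⁻¹ = 1 / (l - 1) := by
    have : l ≠ 0 := by positivity
    have : l - 1 ≠ 0 := by linarith
    rw [← mul_inv, mul_sub, mul_inv_cancel₀ ‹l ≠ 0›, mul_one, one_div]
  rw [e] at h
  refine h.congr_fun ?_
  intro j
  simp [pow_succ, mul_comm]

lemma summ {l : ℝ} (hl : 1 < l) {a : ℕ → ℝ} (ha : Bd a) (n : ℕ) :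
    Summable (fun j : ℕ => a (n + j) / l ^ (j + 1)) := by
  obtain ⟨C, hC⟩ := ha
  refine Summable.of_norm_bounded ((hasSum_geo hl).summable.mul_left C) ?_
  intro j
  have hp : 0 < l ^ (j + 1) := by positivity
  rw [Real.norm_eq_abs, abs_div, abs_of_pos hp, mul_one_div]
  exact div_le_div_of_nonneg_right (hC _) hp.le

lemma V_step {l : ℝ} (hl : 1 < l) {a : ℕ → ℝ} (ha : Bd a) (n : ℕ) :
    l * V l a n = a n + V l a (n + 1) := by
  have hl0 : l ≠ 0 := by positivity
  unfold V
  rw [(summ hl ha n).tsum_eq_zero_add, mul_add, ← tsum_mul_left]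
  congr 1
  · simp; field_simp
  · refine tsum_congr fun j => ?_
    rw [show n + 1 + j = n + (j + 1) by ring]
    field_simp
    ring

lemma V_add {l : ℝ} (hl : 1 < l) {a b : ℕ → ℝ} (ha : Bd a) (hb : Bd b) (n : ℕ) :
    V l (fun m => a m + b m) n = V l a n + V l b n := by
  unfold V
  rw [← (summ hl ha n).tsum_add (summ hl hb n)]
  exact tsum_congr fun j => add_div _ _ _

lemma V_smul {l : ℝ} (c : ℝ) (a : ℕ → ℝ) (n : ℕ) :
    V l (fun m => c * a m) n = c * V l a n := by
  unfold V
  rw [← tsum_mul_left]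
  exact tsum_congr fun j => mul_div_assoc _ _ _

lemma V_const {l : ℝ} (hl : 1 < l) (c : ℝ) (n : ℕ) :
    V l (fun _ => c) n = c / (l - 1) := by
  unfold V
  have := ((hasSum_geo hl).mul_left c).tsum_eq
  simpa only [mul_one_div] using this

lemma V_sum {l : ℝ} (hl : 1 < l) {K : ℕ} {a : ℕ → ℕ → ℝ} (ha : ∀ k, Bd (a k)) (n : ℕ) :
    V l (fun m => ∑ k ∈ Finset.range K, a k m) n = ∑ k ∈ Finset.range K, V l (a k) n := by
  unfold V
  rw [← Summable.tsum_finsetSum (fun k _ => summ hl (ha k) n)]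
  exact tsum_congr fun j => Finset.sum_div _ _ _

lemma V_mono {l : ℝ} (hl : 1 < l) {a b : ℕ → ℝ} (ha : Bd a) (hb : Bd b) (h : ∀ m, a m ≤ b m)
    (n : ℕ) : V l a n ≤ V l b n := by
  unfold V
  refine (summ hl ha n).tsum_le_tsum (fun j => ?_) (summ hl hb n)
  exact div_le_div_of_nonneg_right (h _) (by positivity)

lemma V_nonneg {l : ℝ} (hl : 1 < l) {a : ℕ → ℝ} (h : ∀ m, 0 ≤ a m)
    (n : ℕ) : 0 ≤ V l a n := by
  unfold V
  exact tsum_nonneg fun j => div_nonneg (h _) (by positivity)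

lemma V_shift {l : ℝ} {a : ℕ → ℝ} {n : ℕ} (h : ∀ j, a (n + j) = a j) : V l a n = V l a 0 := by
  unfold V
  exact tsum_congr fun j => by rw [h, zero_add]

noncomputable def ind (x : ℕ → ℝ) (y : ℝ) (m : ℕ) : ℝ := if y < x m then 1 else 0

lemma ind_nonneg (x : ℕ → ℝ) (y : ℝ) (m : ℕ) : 0 ≤ ind x y m := by unfold ind; split_ifs <;> norm_num
lemma ind_le (x : ℕ → ℝ) (y : ℝ) (m : ℕ) : ind x y m ≤ 1 := by unfold ind; split_ifs <;> norm_num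
lemma ind_bd (x : ℕ → ℝ) (y : ℝ) : Bd (ind x y) :=
  ⟨1, fun m => by rw [abs_of_nonneg (ind_nonneg x y m)]; exact ind_le x y m⟩

lemma const_bd (c : ℝ) : Bd (fun _ => c) := ⟨|c|, fun _ => le_rfl⟩

structure Orb (α β : ℝ) (x : ℕ → ℝ) (u : ℕ → ℕ) : Prop where
  a0 : 0 ≤ α
  a1 : α < 1
  b1 : 1 < β
  x0 : x 0 = 0
  nn : ∀ n, 0 ≤ x n
  lt : ∀ n, x n < 1
  step : ∀ n, β * x n + α = u n + x (n + 1)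

variable {α β : ℝ} {x : ℕ → ℝ} {u : ℕ → ℕ}

lemma Orb.u_le (h : Orb α β x u) {a b : ℕ} (hab : x b ≤ x a) : u b ≤ u a := by
  by_contra hc
  have hc : u a + 1 ≤ u b := by omega
  have hc' : (u a : ℝ) + 1 ≤ u b := by exact_mod_cast hc
  have := h.step a; have := h.step b; have := h.lt (a+1); have := h.nn (b+1)
  have := mul_le_mul_of_nonneg_left hab (by linarith [h.b1] : (0:ℝ) ≤ β)
  linarith

lemma Orb.shift (h : Orb α β x u) {n : ℕ} (hn : x n = 0) (j : ℕ) : x (n + j) = x j := by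
  induction j with
  | zero => simp [hn, h.x0]
  | succ j ih =>
    have hu : u (n + j) = u j := le_antisymm (h.u_le ih.le) (h.u_le ih.ge)
    have h1 := h.step (n + j); have h2 := h.step j
    rw [ih, hu] at h1
    rw [← add_assoc]; linarith

lemma Orb.shift_u (h : Orb α β x u) {n : ℕ} (hn : x n = 0) (j : ℕ) : u (n + j) = u j :=
  le_antisymm (h.u_le (h.shift hn j).le) (h.u_le (h.shift hn j).ge)

lemma Orb.u_lt (h : Orb α β x u) (n : ℕ) : (u n : ℝ) < β + 1 := by
  have := h.step n; have := h.nn (n+1); have := h.a1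
  have := mul_le_mul_of_nonneg_left (h.lt n).le (by linarith [h.b1] : (0:ℝ) ≤ β)
  linarith

lemma Orb.u_bd (h : Orb α β x u) : Bd (fun n => (u n : ℝ)) :=
  ⟨β + 1, fun n => by rw [abs_of_nonneg (by positivity)]; exact (h.u_lt n).le⟩

lemma Orb.x_bd (h : Orb α β x u) : Bd x :=
  ⟨1, fun n => by rw [abs_of_nonneg (h.nn n)]; exact (h.lt n).le⟩

/-- value formula -/
lemma Orb.s_eq (h : Orb α β x u) {l : ℝ} (hl : 1 < l) (n : ℕ) :
    V l (fun m => (u m : ℝ)) n = α / (l - 1) + x n + (β - l) * V l x n := by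
  have hx := h.x_bd
  have hx' : Bd (fun m => x (m + 1)) := by
    obtain ⟨C, hC⟩ := hx; exact ⟨C, fun m => hC _⟩
  have hbx : Bd (fun m => β * x m) := by
    obtain ⟨C, hC⟩ := hx
    exact ⟨|β| * C, fun m => by rw [abs_mul]; exact mul_le_mul_of_nonneg_left (hC m) (abs_nonneg _)⟩
  have e1 : V l (fun m => β * x m + α) n = V l (fun m => (u m : ℝ) + x (m + 1)) n := by
    congr 1; funext m; exact h.step m
  rw [V_add hl hbx (const_bd α), V_add hl h.u_bd hx', V_smul, V_const hl] at e1
  have e2 : V l (fun m => x (m + 1)) n = V l x (n + 1) := by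
    unfold V; exact tsum_congr fun j => by rw [show n + 1 + j = n + j + 1 by ring]
  have e3 := V_step hl hx n
  rw [e2] at e1
  linarith

/-- strict positivity at zero -/
lemma Orb.F_pos (h : Orb α β x u) {l : ℝ} (hl : 1 < l) {n : ℕ} (hn : 0 < x n) :
    V l (ind x 0) 0 < V l (ind x 0) n := by
  set f := V l (ind x 0) 0 with hf
  have hl0 : 0 < l := by linarith
  have hf0 : 0 ≤ f := V_nonneg hl (ind_nonneg x 0) 0
  have i0 : ind x 0 0 = 0 := by simp [ind, h.x0]
  have hf1 : l * f ≤ 1 / (l - 1) := by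
    rw [hf, V_step hl (ind_bd x 0), i0, zero_add, ← V_const hl 1 (0 + 1)]
    exact V_mono hl (ind_bd x 0) (const_bd 1) (ind_le x 0) _
  have hf2 : (l - 1) * f < 1 := by
    rw [le_div_iff₀ (by linarith)] at hf1
    have : 0 ≤ (l - 1) * f := mul_nonneg (by linarith) hf0
    nlinarith
  have hz : ∀ n, x n = 0 → V l (ind x 0) n = f := fun n hn =>
    V_shift fun j => by simp [ind, h.shift hn j]
  have key : ∀ k n, f - f / l ^ k ≤ V l (ind x 0) n := by
    intro k
    induction k with
    | zero => intro n; simpa using V_nonneg hl (ind_nonneg x 0) n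
    | succ k ih =>
      intro n
      rcases (h.nn n).eq_or_lt with hn | hn
      · rw [hz n hn.symm]
        have : 0 ≤ f / l ^ (k + 1) := by positivity
        linarith
      · have e := V_step hl (ind_bd x 0) n
        have i1 : ind x 0 n = 1 := by simp [ind, hn]
        have := ih (n + 1)
        have e' : l * (f / l ^ (k + 1)) = f / l ^ k := by field_simp; ring
        refine le_of_mul_le_mul_left ?_ hl0
        rw [e, mul_sub, e', i1]; linarith
  have lim : ∀ n, f ≤ V l (ind x 0) n := by
    intro n
    have t : Tendsto (fun k : ℕ => f - f / l ^ k) atTop (nhds (f - 0)) :=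
      tendsto_const_nhds.sub (tendsto_const_nhds.div_atTop (tendsto_pow_atTop_atTop_of_one_lt hl))
    rw [sub_zero] at t
    exact le_of_tendsto' t fun k => key k n
  have e := V_step hl (ind_bd x 0) n
  have i1 : ind x 0 n = 1 := by simp [ind, hn]
  have := lim (n + 1)
  refine lt_of_mul_lt_mul_left ?_ hl0.le
  rw [e, i1]; linarith

lemma F_anti {l : ℝ} (hl : 1 < l) (x : ℕ → ℝ) (n : ℕ) : Antitone (fun y => V l (ind x y) n) := by
  intro y z hyz
  refine V_mono hl (ind_bd x z) (ind_bd x y) (fun m => ?_) n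
  unfold ind
  split_ifs <;> linarith

lemma F_right {l : ℝ} (hl : 1 < l) (x : ℕ → ℝ) (n : ℕ) :
    Tendsto (fun y => V l (ind x y) n) (nhdsWithin 0 (Set.Ioi 0)) (nhds (V l (ind x 0) n)) := by
  unfold V
  refine tendsto_tsum_of_dominated_convergence (hasSum_geo hl).summable (fun j => ?_) ?_
  · refine Tendsto.congr' ?_ tendsto_const_nhds
    by_cases hp : 0 < x (n + j)
    · filter_upwards [Ioo_mem_nhdsGT hp] with y hy
      simp [ind, hp, hy.2]
    · filter_upwards [self_mem_nhdsWithin] with y hy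
      have hy : 0 < y := hy
      have : ¬ y < x (n + j) := by linarith
      simp [ind, hp, this]
  · refine Eventually.of_forall fun y j => ?_
    have hp : 0 < l ^ (j + 1) := by positivity
    rw [Real.norm_eq_abs, abs_div, abs_of_pos hp, abs_of_nonneg (ind_nonneg _ _ _)]
    exact div_le_div_of_nonneg_right (ind_le _ _ _) hp.le

lemma count (K U : ℕ) (hU : U < K) (y z : ℝ) (hy0 : 0 ≤ y) (hy1 : y < 1) (hz0 : 0 ≤ z) (hz1 : z < 1) :
    ∑ k ∈ Finset.range K, (if y + k < U + z then (1:ℝ) else 0) = U + if y < z then 1 else 0 := by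
  obtain ⟨r, rfl⟩ : ∃ r, K = U + 1 + r := ⟨K - (U + 1), by omega⟩
  rw [Finset.sum_range_add, Finset.sum_range_succ]
  have h1 : ∑ k ∈ Finset.range U, (if y + k < U + z then (1:ℝ) else 0) = U := by
    rw [Finset.sum_congr rfl (g := fun _ => (1:ℝ))]
    · simp
    · intro k hk
      have : k + 1 ≤ U := by have := Finset.mem_range.1 hk; omega
      have : (k : ℝ) + 1 ≤ U := by exact_mod_cast this
      rw [if_pos (by linarith)]
  have h2 : ∑ k ∈ Finset.range r, (if y + ((U + 1 + k : ℕ) : ℝ) < U + z then (1:ℝ) else 0) = 0 := by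
    refine Finset.sum_eq_zero fun k _ => ?_
    have : (0:ℝ) ≤ k := by positivity
    push_cast
    rw [if_neg (by linarith)]
  rw [h1, h2, add_zero]
  congr 1
  have : (y + (U:ℝ) < U + z) ↔ y < z := by constructor <;> intro <;> linarith
  simp only [this]

lemma Orb.transfer (h : Orb α β x u) {l : ℝ} (hl : 1 < l) {K : ℕ} (hK : β + 1 ≤ K)
    {y : ℝ} (hy0 : 0 ≤ y) (hy1 : y < 1) (n : ℕ) :
    ∑ k ∈ Finset.range K, V l (ind x ((y + k - α) / β)) n
      = V l (fun m => (u m : ℝ)) n + l * V l (ind x y) n - ind x y n := by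
  rw [← V_sum hl (fun k => ind_bd x _)]
  have hb : 0 < β := by linarith [h.b1]
  have e : (fun m => ∑ k ∈ Finset.range K, ind x ((y + k - α) / β) m)
      = fun m => (u m : ℝ) + ind x y (m + 1) := by
    funext m
    have hU : u m < K := by exact_mod_cast (h.u_lt m).trans_le hK
    have := count K (u m) hU y (x (m+1)) hy0 hy1 (h.nn _) (h.lt _)
    unfold ind
    rw [← this]
    refine Finset.sum_congr rfl fun k _ => ?_
    have : ((y + k - α) / β < x m) ↔ (y + k < u m + x (m + 1)) := by
      rw [div_lt_iff₀ hb, ← h.step m]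
      constructor <;> intro <;> linarith
    simp only [this]
  have hb' : Bd (fun m => ind x y (m + 1)) := by
    obtain ⟨C, hC⟩ := ind_bd x y; exact ⟨C, fun m => hC _⟩
  rw [e, V_add hl h.u_bd hb']
  have e2 : V l (fun m => ind x y (m + 1)) n = V l (ind x y) (n + 1) := by
    unfold V; exact tsum_congr fun j => by rw [show n + 1 + j = n + j + 1 by ring]
  have e3 := V_step hl (ind_bd x y) n
  rw [e2]; linarith

lemma int_comp {G : ℝ → ℝ} (hG : ∀ a b, IntervalIntegrable G volume a b) (hb : 0 < β) (k : ℕ) :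
    IntervalIntegrable (fun y : ℝ => G ((y + k - α) / β)) volume 0 1 := by
  have h1 := (hG ((0 + k - α) / β) ((1 + k - α) / β)).comp_mul_right (c := β⁻¹)
  have h2 := h1.comp_add_right ((k:ℝ) - α)
  convert h2 using 1
  · funext y; congr 1; ring
  · field_simp; ring
  · field_simp; ring

lemma int_transfer {G : ℝ → ℝ} (hG : ∀ a b, IntervalIntegrable G volume a b)
    (hneg : ∀ y < 0, G y = 0) (hbig : ∀ y ≥ 1, G y = 0) (hb : 0 < β) (ha : 0 ≤ α) (ha1 : α < 1) {K : ℕ}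
    (hK : β + 1 ≤ K) :
    ∫ y in (0:ℝ)..1, ∑ k ∈ Finset.range K, G ((y + k - α) / β) = β * ∫ y in (0:ℝ)..1, G y := by
  have hc : ∀ k : ℕ, (fun y : ℝ => G ((y + k - α) / β)) = fun y => G (y / β + (k - α) / β) := by
    intro k; funext y; congr 1; ring
  have hi : ∀ k : ℕ, IntervalIntegrable (fun y : ℝ => G ((y + k - α) / β)) volume 0 1 := by
    exact fun k => int_comp hG hb k
  rw [intervalIntegral.integral_finsetSum (fun k _ => hi k)]
  have e : ∀ k : ℕ, ∫ y in (0:ℝ)..1, G ((y + k - α) / β)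
      = β * ∫ y in ((k:ℝ) - α) / β..(((k + 1 : ℕ) : ℝ) - α) / β, G y := by
    intro k
    rw [hc k, intervalIntegral.integral_comp_div_add _ hb.ne', smul_eq_mul]
    congr 2 <;> (push_cast; ring)
  simp_rw [e]
  rw [← Finset.mul_sum, intervalIntegral.sum_integral_adjacent_intervals
    (a := fun k : ℕ => ((k:ℝ) - α) / β) (fun k _ => hG _ _)]
  congr 1
  have z1 : ∫ y in (((0:ℕ):ℝ) - α) / β..0, G y = 0 := by
    refine intervalIntegral.integral_zero_ae ?_
    have hne : ∀ᵐ y : ℝ ∂volume, y ≠ 0 := by simp [ae_iff]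
    filter_upwards [hne] with y hy hm
    have hle : (((0:ℕ):ℝ) - α) / β ≤ 0 := div_nonpos_of_nonpos_of_nonneg (by simpa using ha) hb.le
    rw [Set.uIoc_of_le hle] at hm
    exact hneg y (lt_of_le_of_ne hm.2 hy)
  have z2 : ∫ y in (1:ℝ)..((K:ℝ) - α) / β, G y = 0 := by
    refine intervalIntegral.integral_zero_ae (Eventually.of_forall fun y hm => ?_)
    have hle : 1 ≤ ((K:ℝ) - α) / β := by rw [le_div_iff₀ hb]; linarith
    rw [Set.uIoc_of_le hle] at hm
    exact hbig y hm.1.le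
  rw [← intervalIntegral.integral_add_adjacent_intervals (hG _ 0) (hG 0 _), z1,
    ← intervalIntegral.integral_add_adjacent_intervals (hG 0 1) (hG 1 _), z2]
  ring

lemma Orb.D_lt (h : Orb α β x u) {l : ℝ} (hl : β < l) (n : ℕ) :
    V l (fun m => (u m : ℝ)) n - V l (fun m => (u m : ℝ)) 0 < 1 := by
  have hl1 : 1 < l := h.b1.trans hl
  rcases (h.nn n).eq_or_lt with hn | hn
  · rw [V_shift (fun j => by rw [h.shift_u hn.symm j])]; norm_num
  by_contra hD
  push Not at hD
  set H : ℝ → ℝ := fun y => V l (ind x y) n - V l (ind x y) 0 with hH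
  set G : ℝ → ℝ := fun y => max (H y) 0 with hGdef
  have hHi : ∀ a b, IntervalIntegrable H volume a b := fun a b =>
    ((F_anti hl1 x n).intervalIntegrable).sub ((F_anti hl1 x 0).intervalIntegrable)
  have hGi : ∀ a b, IntervalIntegrable G volume a b := by
    intro a b
    have := ((hHi a b).add (hHi a b).abs).div_const 2
    refine this.congr (fun y _ => ?_)
    simp only [hGdef, Pi.add_apply]
    rcases le_total 0 (H y) with hh | hh
    · rw [abs_of_nonneg hh, max_eq_left hh]; ring
    · rw [abs_of_nonpos hh, max_eq_right hh]; ring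
  have hG0 : ∀ y, 0 ≤ G y := fun y => le_max_right _ _
  have hneg : ∀ y < 0, G y = 0 := by
    intro y hy
    have e : ind x y = fun _ => 1 := by
      funext m; simp [ind, lt_of_lt_of_le hy (h.nn m)]
    simp [hGdef, hH, e, V_const hl1]
  have hbig : ∀ y ≥ 1, G y = 0 := by
    intro y hy
    have e : ind x y = fun _ => 0 := by
      funext m; simp [ind, ((h.lt m).le.trans hy)]
    simp [hGdef, hH, e, V_const hl1]
  obtain ⟨K, hK⟩ := exists_nat_ge (β + 1)
  have hb : 0 < β := by linarith [h.b1]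
  have hI := int_transfer hGi hneg hbig hb h.a0 h.a1 hK
  have hpt : ∀ y ∈ Set.Ioo (0:ℝ) 1, l * G y ≤ ∑ k ∈ Finset.range K, G ((y + k - α) / β) := by
    intro y hy
    have hn1 : 0 ≤ ∑ k ∈ Finset.range K, G ((y + k - α) / β) := Finset.sum_nonneg fun k _ => hG0 _
    have h1 := h.transfer hl1 hK hy.1.le hy.2 n
    have h2 := h.transfer hl1 hK hy.1.le hy.2 0
    have h3 : ∑ k ∈ Finset.range K, H ((y + k - α) / β) ≤ ∑ k ∈ Finset.range K, G ((y + k - α) / β) :=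
      Finset.sum_le_sum fun k _ => le_max_left _ _
    have h4 : l * H y ≤ ∑ k ∈ Finset.range K, H ((y + k - α) / β) := by
      simp only [hH, Finset.sum_sub_distrib]
      rw [h1, h2]
      have := ind_le x y n
      have := ind_nonneg x y 0
      linarith
    rcases le_total 0 (H y) with hh | hh
    · simp only [hGdef, max_eq_left hh] at *; linarith
    · have : G y = 0 := max_eq_right hh
      rw [this, mul_zero]; exact hn1
  have hi : IntervalIntegrable (fun y => ∑ k ∈ Finset.range K, G ((y + k - α) / β)) volume 0 1 := by
    have := IntervalIntegrable.sum (μ := volume) (a := 0) (b := 1) (Finset.range K)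
      (f := fun (k : ℕ) (y : ℝ) => G ((y + k - α) / β)) (fun k _ => int_comp hGi hb k)
    have e : (∑ k ∈ Finset.range K, fun y : ℝ => G ((y + k - α) / β))
        = fun y => ∑ k ∈ Finset.range K, G ((y + k - α) / β) := by
      funext y
      simp
    rw [e] at this
    exact this
  have hle : l * ∫ y in (0:ℝ)..1, G y ≤ β * ∫ y in (0:ℝ)..1, G y := by
    rw [← hI, ← intervalIntegral.integral_const_mul]
    exact intervalIntegral.integral_mono_on_of_le_Ioo zero_le_one ((hGi 0 1).const_mul l) hi hpt
  have hIle : ∫ y in (0:ℝ)..1, G y ≤ 0 := by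
    by_contra hc
    push Not at hc
    nlinarith
  -- lower bound near zero
  have hpos : 0 < H 0 := sub_pos.2 (h.F_pos hl1 hn)
  have ht : Tendsto H (nhdsWithin 0 (Set.Ioi 0)) (nhds (H 0)) :=
    (F_right hl1 x n).sub (F_right hl1 x 0)
  have hev := ht.eventually (lt_mem_nhds (half_lt_self hpos))
  obtain ⟨d, hd, hdd⟩ := (mem_nhdsGT_iff_exists_Ioo_subset).1 hev
  have hd : 0 < d := hd
  set e := min d 1 with he
  have he0 : 0 < e := lt_min hd one_pos
  have e1 : ∫ y in (0:ℝ)..e, H 0 / 2 ≤ ∫ y in (0:ℝ)..e, G y := by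
    refine intervalIntegral.integral_mono_on_of_le_Ioo he0.le (by simp) (hGi 0 e) fun y hy => ?_
    have : H 0 / 2 < H y := hdd ⟨hy.1, hy.2.trans_le (min_le_left _ _)⟩
    exact this.le.trans (le_max_left _ _)
  have e2 : 0 ≤ ∫ y in e..1, G y :=
    intervalIntegral.integral_nonneg (min_le_right _ _) fun y _ => hG0 y
  have e3 := intervalIntegral.integral_add_adjacent_intervals (hGi 0 e) (hGi e 1)
  rw [intervalIntegral.integral_const, smul_eq_mul, sub_zero] at e1
  have : 0 < e * (H 0 / 2) := by positivity
  linarith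

lemma Orb.D_lt' (h : Orb α β x u) {l : ℝ} (hl : β ≤ l) (n : ℕ) :
    V l (fun m => (u m : ℝ)) n - V l (fun m => (u m : ℝ)) 0 < 1 := by
  rcases hl.eq_or_lt with rfl | hl
  · rw [h.s_eq h.b1, h.s_eq h.b1, h.x0]
    have := h.lt n
    linarith
  · exact h.D_lt hl n

lemma Orb.D_nonneg (h : Orb α β x u) {l : ℝ} (hl : β ≤ l) (n : ℕ) :
    0 ≤ V l (fun m => (u m : ℝ)) n - V l (fun m => (u m : ℝ)) 0 := by
  have hl1 : 1 < l := h.b1.trans_le hl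
  have hl0 : 0 < l := by linarith
  set s := V l (fun m => (u m : ℝ)) with hs
  obtain ⟨M, hM⟩ : ∃ M, M = (β + 1) / (l - 1) := ⟨_, rfl⟩
  have hsM : ∀ n, s n ≤ M := fun n => by
    rw [hM, ← V_const hl1 (β + 1) n]
    exact V_mono hl1 h.u_bd (const_bd _) (fun m => (h.u_lt m).le) n
  have hs0 : ∀ n, 0 ≤ s n := fun n => V_nonneg hl1 (fun m => by positivity) n
  have hst : ∀ n, l * s n = u n + s (n + 1) := V_step hl1 h.u_bd
  have hD : ∀ n, s n - s 0 < 1 := h.D_lt' hl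
  have key : ∀ i a b, x b ≤ x a → - (M / l ^ i) ≤ s a - s b := by
    intro i
    induction i with
    | zero =>
      intro a b _
      have := hsM b; have := hs0 a
      simp only [pow_zero, div_one]; linarith
    | succ i ih =>
      intro a b hab
      have e' : l * (M / l ^ (i + 1)) = M / l ^ i := by field_simp; ring
      refine le_of_mul_le_mul_left ?_ hl0
      rw [mul_neg, e', mul_sub, hst, hst]
      rcases (h.u_le hab).eq_or_lt with hu | hu
      · have hx : x (b + 1) ≤ x (a + 1) := by
          have h1 := h.step a; have h2 := h.step b
          rw [hu] at h2
          have := mul_le_mul_of_nonneg_left hab (by linarith [h.b1] : (0:ℝ) ≤ β)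
          linarith
        have := ih _ _ hx
        rw [hu]; linarith
      · have hu' : (u b : ℝ) + 1 ≤ u a := by exact_mod_cast hu
        have h1 := ih (a + 1) 0 (by rw [h.x0]; exact h.nn _)
        have h2 := hD (b + 1)
        linarith
  have t : Tendsto (fun k : ℕ => - (M / l ^ k)) atTop (nhds (-0)) :=
    (tendsto_const_nhds.div_atTop (tendsto_pow_atTop_atTop_of_one_lt hl1)).neg
  rw [neg_zero] at t
  exact le_of_tendsto' t fun k => key k n 0 (by rw [h.x0]; exact h.nn _)

lemma orb_code (α β : ℝ) (hα : α ∈ Set.Ico (0 : ℝ) 1) (hβ : 1 < β) :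
    Orb α β (fun n => (Tab α β)^[n] 0) (code α β 0) := by
  have hnn : ∀ n, 0 ≤ (Tab α β)^[n] 0 := by
    intro n
    cases n with
    | zero => simp
    | succ n => rw [Function.iterate_succ_apply']; exact Int.fract_nonneg _
  refine ⟨hα.1, hα.2, hβ, rfl, hnn, ?_, ?_⟩
  · intro n
    cases n with
    | zero => simp
    | succ n => simp only [Function.iterate_succ_apply']; exact Int.fract_lt_one _
  · intro n
    simp only [Function.iterate_succ_apply', code]
    have h0 : 0 ≤ β * (Tab α β)^[n] 0 + α :=
      add_nonneg (mul_nonneg (by linarith) (hnn n)) hα.1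
    have h1 : (((⌊β * (Tab α β)^[n] 0 + α⌋).toNat : ℕ) : ℝ) = ((⌊β * (Tab α β)^[n] 0 + α⌋ : ℤ) : ℝ) := by
      have : ((⌊β * (Tab α β)^[n] 0 + α⌋.toNat : ℕ) : ℤ) = ⌊β * (Tab α β)^[n] 0 + α⌋ :=
        Int.toNat_of_nonneg (Int.floor_nonneg.2 h0)
      exact_mod_cast this
    rw [h1]
    exact (Int.floor_add_fract _).symm

end CKC

/-- If `u = i^{α,β}(0)`, then for every `β' ≥ β`, setting
`α' = (β'-1)·Σ_j u_j·β'^{-(j+1)}`, one has `α' ∈ [0,1)`, `α' ≤ α` and `i^{α',β'}(0) = u`. -/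
theorem curve_keeps_coding (α β : ℝ) (hα : α ∈ Set.Ico (0 : ℝ) 1) (hβ : 1 < β) :
    ∀ β' : ℝ, β ≤ β' →
      ((β' - 1) * ∑' j : ℕ, (code α β 0 j : ℝ) / β' ^ (j + 1)) ∈ Set.Ico (0 : ℝ) 1 ∧
      (β' - 1) * ∑' j : ℕ, (code α β 0 j : ℝ) / β' ^ (j + 1) ≤ α ∧
      code ((β' - 1) * ∑' j : ℕ, (code α β 0 j : ℝ) / β' ^ (j + 1)) β' 0 = code α β 0 := by
  intro β' hb
  have h := CKC.orb_code α β hα hβ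
  have hb1 : 1 < β' := hβ.trans_le hb
  have hV : ∑' j : ℕ, (code α β 0 j : ℝ) / β' ^ (j + 1)
      = CKC.V β' (fun m => (code α β 0 m : ℝ)) 0 := by
    unfold CKC.V; simp only [zero_add]
  rw [hV]
  set s := CKC.V β' (fun m => (code α β 0 m : ℝ)) with hs
  obtain ⟨α', hα'⟩ : ∃ a, a = (β' - 1) * s 0 := ⟨_, rfl⟩
  rw [← hα']
  have hle : α' ≤ α := by
    have e := h.s_eq hb1 0
    have hX := CKC.V_nonneg hb1 h.nn 0
    have : s 0 ≤ α / (β' - 1) := by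
      rw [hs, e, h.x0]
      have : (β - β') * CKC.V β' (fun n => (Tab α β)^[n] 0) 0 ≤ 0 :=
        mul_nonpos_of_nonpos_of_nonneg (by linarith) hX
      linarith
    rw [le_div_iff₀ (by linarith)] at this
    linarith
  have h0 : 0 ≤ α' := by
    rw [hα']
    exact mul_nonneg (by linarith) (CKC.V_nonneg hb1 (fun m => by positivity) 0)
  refine ⟨⟨h0, hle.trans_lt hα.2⟩, hle, ?_⟩
  have hst : ∀ n, β' * s n = code α β 0 n + s (n + 1) := CKC.V_step hb1 h.u_bd
  have hfl : ∀ n, ⌊β' * (s n - s 0) + α'⌋ = (code α β 0 n : ℤ) := by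
    intro n
    have := hst n
    have l1 := h.D_nonneg hb (n + 1)
    have l2 := h.D_lt' hb (n + 1)
    rw [← hs] at l1 l2
    have e : β' * (s n - s 0) + α' = code α β 0 n + (s (n + 1) - s 0) := by
      rw [hα', mul_sub, this]; ring
    rw [Int.floor_eq_iff, e]
    push_cast
    constructor <;> linarith
  have hit : ∀ n, (Tab α' β')^[n] 0 = s n - s 0 := by
    intro n
    induction n with
    | zero => simp
    | succ n ih =>
      rw [Function.iterate_succ_apply', ih, Tab, Int.fract, hfl, hα', mul_sub, hst]
      push_cast; ring
  funext n
  show (⌊β' * (Tab α' β')^[n] 0 + α'⌋).toNat = _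
  rw [hit, hfl]
  simp
end

section
/- Fix an integer k ≥ 2 and a sign sequence s_0,…,s_{k−1} ∈ {−1,+1}. Then the set {β ∈ (k−1, k] : there exist n ≥ 0 and j ∈ {1,…,k−1} with T_β^n(1) = j/β} is countable; that is, for all but countably many β ∈ (k−1,k], the orbit of 1 under the generalized β-map T_β never hits a discontinuity point j/β. -/
/-- The lap index of `x` for the generalized `β`-map with `k` branches:
`j(x) = min(⌊β·x⌋, k-1)`. -/
noncomputable def lapIdx (k : ℕ) (β : ℝ) (x : ℝ) : ℕ :=
  min (⌊β * x⌋.toNat) (k - 1)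

/-- The generalized `β`-map determined by `k` branches and a sign sequence `s`:
on the lap `j = j(x)`, it is `β·x - j` if `s j = +1` and `1 - (β·x - j)` if `s j = -1`. -/
noncomputable def genBetaMap (k : ℕ) (s : ℕ → ℤ) (β : ℝ) (x : ℝ) : ℝ :=
  if s (lapIdx k β x) = 1 then β * x - (lapIdx k β x : ℝ)
  else 1 - (β * x - (lapIdx k β x : ℝ))

/-- The digit sequence of the critical orbit of `1`: `d_n(β) = j(T_β^n(1))`. -/
noncomputable def genDigit (k : ℕ) (s : ℕ → ℤ) (β : ℝ) (n : ℕ) : ℕ :=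
  lapIdx k β ((genBetaMap k s β)^[n] 1)

theorem genBetaMap_iterate_poly (k : ℕ) (s : ℕ → ℤ) (β : ℝ) (n : ℕ) :
    ∃ p : Polynomial ℤ, (genBetaMap k s β)^[n] 1 = Polynomial.aeval β p := by
  induction n with
  | zero => exact ⟨1, by simp⟩
  | succ n ih =>
    obtain ⟨p, hp⟩ := ih
    rw [Function.iterate_succ_apply', hp]
    generalize hx : (Polynomial.aeval β p : ℝ) = x
    unfold genBetaMap
    split_ifs
    · exact ⟨Polynomial.X * p - (lapIdx k β x : Polynomial ℤ), by simp [hx]⟩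
    · exact ⟨1 - (Polynomial.X * p - (lapIdx k β x : Polynomial ℤ)), by simp [hx]⟩

/-- For any family of generalized `β`-maps, the set of `β ∈ (k-1,k]` for which the orbit of `1`
hits a discontinuity point `j/β` is countable. -/
theorem countable_beta_orbit_hits_discontinuity (k : ℕ) (hk : 2 ≤ k) (s : ℕ → ℤ)
    (hs : ∀ i < k, s i = 1 ∨ s i = -1) :
    Set.Countable {β : ℝ | β ∈ Set.Ioc ((k : ℝ) - 1) (k : ℝ) ∧
      ∃ n : ℕ, ∃ j : ℕ, 1 ≤ j ∧ j ≤ k - 1 ∧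
        (genBetaMap k s β)^[n] 1 = (j : ℝ) / β} := by
  refine (Algebraic.countable ℤ ℝ).mono ?_
  rintro β ⟨⟨hβ, -⟩, n, j, hj, -, h⟩
  have hk' : (2 : ℝ) ≤ k := by exact_mod_cast hk
  have hβ0 : β ≠ 0 := by
    intro h0
    linarith
  obtain ⟨p, hp⟩ := genBetaMap_iterate_poly k s β n
  rw [hp, eq_div_iff hβ0] at h
  refine ⟨Polynomial.X * p - (j : Polynomial ℤ), ?_, ?_⟩
  · intro h0
    have h1 := congrArg (Polynomial.eval 0) h0
    simp at h1
    omega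
  · simp [← h, mul_comm]
end

section
/- Fix an integer k ≥ 3 and a sign sequence s_0,…,s_{k−1} ∈ {−1,+1}, and consider the family of generalized β-maps T_β for β ∈ (k−1,k]. For every β₀ > 2 there exists K > 0 such that for all β₁, β₂ with β₀ ≤ β₁ ≤ β₂, k−1 < β₁ and β₂ ≤ k, and for every l ∈ ℕ: if the digit sequences of 1 agree up to index l, i.e., d_n(β₁) = d_n(β₂) for all n < l, then β₂ − β₁ ≤ K·β₂^{-l}. -/
lemma genBetaMap_mem (k : ℕ) (hk : 3 ≤ k) (s : ℕ → ℤ) (β x : ℝ) (h0 : 0 ≤ β) (hβ : β ≤ k)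
    (hx0 : 0 ≤ x) (hx1 : x ≤ 1) : 0 ≤ genBetaMap k s β x ∧ genBetaMap k s β x ≤ 1 := by
  have hp : 0 ≤ β * x := mul_nonneg h0 hx0
  have hle : β * x ≤ k := by nlinarith
  have key : 0 ≤ β * x - (lapIdx k β x : ℝ) ∧ β * x - (lapIdx k β x : ℝ) ≤ 1 := by
    unfold lapIdx
    have e : ⌊β * x⌋.toNat = ⌊β * x⌋₊ := rfl
    rw [e]
    have h1 := Nat.floor_le hp
    have h2 := Nat.lt_floor_add_one (β * x)
    rcases le_total ⌊β * x⌋₊ (k - 1) with h | h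
    · rw [min_eq_left h]
      constructor <;> linarith
    · rw [min_eq_right h]
      have h3 : ((k - 1 : ℕ) : ℝ) ≤ (⌊β * x⌋₊ : ℝ) := by exact_mod_cast h
      have h4 : ((k - 1 : ℕ) : ℝ) = (k : ℝ) - 1 := by
        rw [Nat.cast_sub (by omega)]; simp
      constructor <;> linarith
  unfold genBetaMap
  split_ifs
  · exact key
  · constructor <;> linarith [key.1, key.2]

lemma genBeta_iter_mem (k : ℕ) (hk : 3 ≤ k) (s : ℕ → ℤ) (β : ℝ) (h0 : 0 ≤ β) (hβ : β ≤ k)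
    (n : ℕ) : 0 ≤ (genBetaMap k s β)^[n] 1 ∧ (genBetaMap k s β)^[n] 1 ≤ 1 := by
  induction n with
  | zero => simp
  | succ n ih =>
    rw [Function.iterate_succ_apply']
    exact genBetaMap_mem k hk s β _ h0 hβ ih.1 ih.2

lemma genBetaMap_diff (k : ℕ) (s : ℕ → ℤ) (β₁ β₂ x y : ℝ)
    (h : lapIdx k β₁ x = lapIdx k β₂ y) :
    |genBetaMap k s β₂ y - genBetaMap k s β₁ x| = |β₂ * y - β₁ * x| := by
  unfold genBetaMap
  rw [h]
  split_ifs
  · congr 1; ring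
  · rw [← abs_neg]; congr 1; ring

theorem genBeta_separation_k_ge_three (k : ℕ) (hk : 3 ≤ k) (s : ℕ → ℤ)
    (hs : ∀ i < k, s i = 1 ∨ s i = -1) (β₀ : ℝ) (hβ₀ : 2 < β₀) :
    ∃ K : ℝ, 0 < K ∧ ∀ β₁ β₂ : ℝ, β₀ ≤ β₁ → β₁ ≤ β₂ →
      (k : ℝ) - 1 < β₁ → β₂ ≤ (k : ℝ) →
      ∀ l : ℕ, (∀ n < l, genDigit k s β₁ n = genDigit k s β₂ n) →
        β₂ - β₁ ≤ K * β₂ ^ (-(l : ℤ)) := by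
  have hb : 0 < β₀ - 2 := by linarith
  have hK : 0 ≤ (k : ℝ) * k / (β₀ - 2) := by positivity
  refine ⟨(k : ℝ) * k / (β₀ - 2) + 1, by linarith, ?_⟩
  intro β₁ β₂ h01 h12 hk1 h2k l hl
  have hδ : 0 ≤ β₂ - β₁ := by linarith
  have hpos : 0 < β₂ := by linarith
  have claim : ∀ m : ℕ, m + 1 ≤ l → (β₂ - β₁) * (β₂ - 2) * β₂ ^ m + (β₂ - β₁) ≤
      (β₂ - 1) * |(genBetaMap k s β₂)^[m+1] 1 - (genBetaMap k s β₁)^[m+1] 1| := by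
    intro m
    induction m with
    | zero =>
      intro hm
      have := genBetaMap_diff k s β₁ β₂ _ _ (hl 0 (by omega))
      simp only [Function.iterate_zero, id, mul_one] at this
      simp only [zero_add, Function.iterate_one, this, abs_of_nonneg hδ, pow_zero]
      linarith
    | succ m ih =>
      intro hm
      have ih := ih (by omega)
      have hd := genBetaMap_diff k s β₁ β₂ _ _ (hl (m+1) (by omega))
      rw [Function.iterate_succ_apply' _ (m+1), Function.iterate_succ_apply' _ (m+1), hd]
      have hx := genBeta_iter_mem k hk s β₁ (by linarith) (by linarith) (m+1)
      set x := (genBetaMap k s β₁)^[m+1] 1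
      set y := (genBetaMap k s β₂)^[m+1] 1
      have h1 : β₂ * |y - x| ≤ |β₂ * y - β₁ * x| + (β₂ - β₁) := by
        have e : β₂ * |y - x| = |(β₂ * y - β₁ * x) - (β₂ - β₁) * x| := by
          rw [← abs_of_pos hpos, ← abs_mul, abs_of_pos hpos]; congr 1; ring
        rw [e]
        refine (abs_sub _ _).trans ?_
        rw [abs_of_nonneg (mul_nonneg hδ hx.1)]
        nlinarith
      have h2 := mul_le_mul_of_nonneg_left h1 (by linarith : 0 ≤ β₂ - 1)
      have h3 := mul_le_mul_of_nonneg_left ih hpos.le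
      rw [pow_succ]
      linarith
  rw [zpow_neg, zpow_natCast, ← div_eq_mul_inv, le_div_iff₀ (by positivity)]
  rcases l with _ | m
  · simp; linarith
  · have hc := claim m le_rfl
    have hx := genBeta_iter_mem k hk s β₁ (by linarith) (by linarith) (m+1)
    have hy := genBeta_iter_mem k hk s β₂ (by linarith) (by linarith) (m+1)
    have ha : |(genBetaMap k s β₂)^[m+1] 1 - (genBetaMap k s β₁)^[m+1] 1| ≤ 1 := by
      rw [abs_le]; constructor <;> linarith [hx.1, hx.2, hy.1, hy.2]
    have h1 : (β₂ - β₁) * (β₂ - 2) * β₂ ^ m ≤ k := by nlinarith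
    have hp : 0 ≤ (β₂ - β₁) * β₂ ^ m := by positivity
    have h2 : (β₂ - β₁) * β₂ ^ m * (β₀ - 2) ≤ k := by
      have := mul_le_mul_of_nonneg_left (by linarith : β₀ - 2 ≤ β₂ - 2) hp
      linarith
    have h3 : (β₂ - β₁) * β₂ ^ (m+1) ≤ (k : ℝ) * k / (β₀ - 2) := by
      rw [le_div_iff₀ hb, pow_succ]
      have := mul_le_mul h2 h2k hpos.le (by positivity)
      linarith
    linarith
end

section
/- Let k = 2 with sign sequence s = (+1,−1) (the tent-map family) or s = (−1,+1), and consider the generalized β-maps T_β for β ∈ (1,2]. For every β₀ > 1 there exists K > 0 such that for all β₁, β₂ with β₀ ≤ β₁ ≤ β₂ ≤ 2 and every l ∈ ℕ: if the digit sequences of 1 agree up to index l, i.e., d_n(β₁) = d_n(β₂) for all n < l, then β₂ − β₁ ≤ K·β₂^{-l}. -/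
/-- Weak tent itinerary of length `l` starting at `1`. -/
def WOrb (a : ℝ) (x : ℕ → ℝ) (e : ℕ → Bool) (l : ℕ) : Prop :=
  x 0 = 1 ∧ ∀ n < l, (e n = false ∧ a * x n ≤ 1 ∧ x (n+1) = a * x n) ∨
    (e n = true ∧ 1 ≤ a * x n ∧ x (n+1) = 2 - a * x n)

/-- The scaled difference recursion. -/
def URec (b : ℝ) (x u : ℕ → ℝ) (e : ℕ → Bool) (l : ℕ) : Prop :=
  u 0 = 0 ∧ ∀ n < l, (e n = false ∧ u (n+1) = b * u n + x n) ∨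
    (e n = true ∧ u (n+1) = -(b * u n + x n))

lemma WOrb.range {a : ℝ} {x : ℕ → ℝ} {e : ℕ → Bool} {l : ℕ} (h : WOrb a x e l)
    (ha : 1 < a) (ha2 : a ≤ 2) : ∀ n ≤ l, 0 ≤ x n ∧ x n ≤ 1 := by
  intro n
  induction n with
  | zero => intro _; rw [h.1]; norm_num
  | succ n ih =>
    intro hn
    obtain ⟨h0, h1⟩ := ih (by omega)
    rcases h.2 n (by omega) with ⟨_, h2, h3⟩ | ⟨_, h2, h3⟩
    · rw [h3]; exact ⟨by positivity, h2⟩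
    · rw [h3]; constructor <;> nlinarith

lemma step1 {a b : ℝ} {x u : ℕ → ℝ} {e : ℕ → Bool} {l : ℕ} (h : WOrb a x e l)
    (hu : URec b x u e l) {n : ℕ} (hn : n < l) (hx : 1 < a * x n) :
    x (n+1) = 2 - a * x n ∧ u (n+1) = -(b * u n + x n) := by
  rcases h.2 n hn with ⟨_, h2, h3⟩ | ⟨h1, h2, h3⟩
  · linarith
  · rcases hu.2 n hn with ⟨h4, _⟩ | ⟨_, h5⟩
    · simp [h1] at h4
    · exact ⟨h3, h5⟩

lemma step0 {a b : ℝ} {x u : ℕ → ℝ} {e : ℕ → Bool} {l : ℕ} (h : WOrb a x e l)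
    (hu : URec b x u e l) {n : ℕ} (hn : n < l) (hx : a * x n < 1) :
    x (n+1) = a * x n ∧ u (n+1) = b * u n + x n := by
  rcases h.2 n hn with ⟨h1, h2, h3⟩ | ⟨_, h2, h3⟩
  · rcases hu.2 n hn with ⟨_, h5⟩ | ⟨h4, _⟩
    · exact ⟨h3, h5⟩
    · simp [h1] at h4
  · linarith

lemma first2 {a b : ℝ} {x u : ℕ → ℝ} {e : ℕ → Bool} {l : ℕ} (h : WOrb a x e l)
    (hu : URec b x u e l) (ha : 1 < a) (hl : 2 ≤ l) :
    x 1 = 2 - a ∧ x 2 = a * (2 - a) ∧ u 1 = -1 ∧ u 2 = -(a + b - 2) := by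
  obtain ⟨h1, h2⟩ := step1 h hu (n := 0) (by omega) (by rw [h.1]; linarith)
  rw [h.1] at h1 h2
  rw [hu.1] at h2
  norm_num at h1 h2
  obtain ⟨h3, h4⟩ := step0 h hu (n := 1) (by omega) (by rw [h1]; nlinarith [sq_pos_of_pos (sub_pos.2 ha)])
  norm_num at h3 h4
  refine ⟨h1, by rw [h3, h1], h2, ?_⟩
  rw [h4, h2, h1]; ring

lemma first4 {a b : ℝ} {x u : ℕ → ℝ} {e : ℕ → Bool} {l : ℕ} (h : WOrb a x e l)
    (hu : URec b x u e l) (ha : 1.41 ≤ a) (ha' : a ≤ 1.6) (hl : 4 ≤ l) :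
    x 4 = 2 - a * (2 - a * (a * (2 - a))) ∧
    u 4 = -(b * (b * (a + b - 2) - a * (2 - a)) + (2 - a * (a * (2 - a)))) := by
  norm_num at ha ha'
  obtain ⟨h1, h2, h3, h4⟩ := first2 h hu (by linarith) (by omega)
  obtain ⟨h5, h6⟩ := step1 h hu (n := 2) (by omega) (by
    rw [h2]
    nlinarith [mul_nonneg (sub_nonneg.2 ha) (sub_nonneg.2 ha'), mul_nonneg (mul_nonneg (sub_nonneg.2 ha) (sub_nonneg.2 ha')) (sub_nonneg.2 ha)])
  norm_num at h5 h6
  obtain ⟨h7, h8⟩ := step1 h hu (n := 3) (by omega) (by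
    rw [h5, h2]
    have : a * (a * (2 - a)) ≤ 1.2 := by
      nlinarith [mul_nonneg (sub_nonneg.2 ha) (sub_nonneg.2 ha'), mul_nonneg (mul_nonneg (sub_nonneg.2 ha) (sub_nonneg.2 ha')) (sub_nonneg.2 ha)]
    nlinarith)
  norm_num at h7 h8
  refine ⟨by rw [h7, h5, h2], ?_⟩
  rw [h8, h6, h5, h4, h2]; ring

lemma first6 {a b : ℝ} {x u : ℕ → ℝ} {e : ℕ → Bool} {l : ℕ} (h : WOrb a x e l)
    (hu : URec b x u e l) (ha : 1.41 ≤ a) (ha' : a ≤ 1.5) (hl : 6 ≤ l) :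
    u 6 = -(b * (b * (b * (b * (a + b - 2) - a * (2 - a)) + (2 - a * (a * (2 - a))))
       - (2 - a * (2 - a * (a * (2 - a))))) + (2 - a * (2 - a * (2 - a * (a * (2 - a)))))) := by
  norm_num at ha ha'
  obtain ⟨h1, h2⟩ := first4 h hu (by norm_num; linarith) (by norm_num; linarith) (by omega)
  set c := a * (a * (2 - a)) with hc
  have hc1 : c ≤ 1.18 := by
    rw [hc]; nlinarith [mul_nonneg (sub_nonneg.2 ha) (sub_nonneg.2 ha'), mul_nonneg (mul_nonneg (sub_nonneg.2 ha) (sub_nonneg.2 ha')) (sub_nonneg.2 ha)]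
  have hc2 : 1.12 ≤ c := by
    rw [hc]; nlinarith [mul_nonneg (sub_nonneg.2 ha) (sub_nonneg.2 ha'), mul_nonneg (mul_nonneg (sub_nonneg.2 ha) (sub_nonneg.2 ha')) (sub_nonneg.2 ha)]
  norm_num at hc1 hc2
  have hx4 : x 4 ≤ 0.86 := by rw [h1]; nlinarith
  have hx4' : 1 < a * x 4 := by rw [h1]; nlinarith
  obtain ⟨h5, h6⟩ := step1 h hu (n := 4) (by omega) hx4'
  norm_num at h5 h6 hx4
  obtain ⟨h7, h8⟩ := step1 h hu (n := 5) (by omega) (by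
    rw [h5]; nlinarith)
  norm_num at h7 h8
  rw [h8, h6, h5, h2, h1]; ring

/-- growth lemma, large slope -/
lemma growA1 {a b : ℝ} {x u : ℕ → ℝ} {e : ℕ → Bool} {l : ℕ} (h : WOrb a x e l)
    (hu : URec b x u e l) (ha : 1 < a) (hab : a ≤ b) (hb : b ≤ 2) (c : ℝ) (n₀ : ℕ)
    (h0 : c * b ^ n₀ ≤ (b - 1) * |u n₀| - 1) :
    ∀ n, n₀ ≤ n → n ≤ l → c * b ^ n ≤ (b - 1) * |u n| - 1 := by
  intro n hn
  induction n, hn using Nat.le_induction with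
  | base => intro _; exact h0
  | succ n hn ih =>
    intro hl
    have ih := ih (by omega)
    obtain ⟨hx0, hx1⟩ := h.range ha (by linarith) n (by omega)
    have h1 : b * |u n| - 1 ≤ |u (n+1)| := by
      have h2 : |u (n+1)| = |b * u n + x n| := by
        rcases hu.2 n (by omega) with ⟨_, h3⟩ | ⟨_, h3⟩
        · rw [h3]
        · rw [h3, abs_neg]
      rw [h2]
      have h3 : |b * u n| ≤ |b * u n + x n| + |x n| := by
        have := abs_sub (b * u n + x n) (x n)
        simpa using this
      rw [abs_mul, abs_of_pos (by linarith : (0:ℝ) < b), abs_of_nonneg hx0] at h3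
      linarith
    rw [pow_succ]
    have h2 : (c * b ^ n) * b ≤ ((b - 1) * |u n| - 1) * b :=
      mul_le_mul_of_nonneg_right ih (by linarith)
    have h3 : (b - 1) * (b * |u n| - 1) ≤ (b - 1) * |u (n+1)| :=
      mul_le_mul_of_nonneg_left h1 (by linarith)
    nlinarith

/-- growth lemma, intermediate slope -/
lemma growA2 {a b : ℝ} {x u : ℕ → ℝ} {e : ℕ → Bool} {l : ℕ} (h : WOrb a x e l)
    (hu : URec b x u e l) (ha : 1 < a) (ha3 : a ^ 2 ≤ 3) (hab : a ≤ b) (hb : b ≤ 2) (t c : ℝ)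
    (ht : t * (a * (b - 1)) = 1) (n₀ : ℕ)
    (h0 : c * b ^ n₀ ≤ -u n₀ - t) :
    ∀ n, n₀ ≤ n → n ≤ l → c * b ^ n ≤ -u n - t ∨ c * b ^ n * b ≤ b * u n + x n - t := by
  intro n hn
  have hb0 : 0 < b := by linarith
  have hb1 : 0 < b - 1 := by linarith
  have htpos : 0 < t := by
    by_contra hcon
    have : 0 < a * (b - 1) := by positivity
    nlinarith
  induction n, hn using Nat.le_induction with
  | base => intro _; exact Or.inl h0
  | succ n hn ih =>
    intro hl
    have ih := ih (by omega)
    obtain ⟨hx0, hx1⟩ := h.range ha (by linarith) n (by omega)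
    have e1 : c * b ^ (n+1) = c * b ^ n * b := by rw [pow_succ]; ring
    rw [e1]
    rcases ih with ih | ih
    · have ih' := mul_le_mul_of_nonneg_right ih hb0.le
      rcases h.2 n (by omega) with ⟨g1, g2, g3⟩ | ⟨g1, g2, g3⟩
      · rcases hu.2 n (by omega) with ⟨_, k⟩ | ⟨k, _⟩
        swap
        · simp [g1] at k
        left
        rw [k]
        have : x n ≤ t * (b - 1) := by
          have : a * x n ≤ a * (t * (b - 1)) := by nlinarith
          exact le_of_mul_le_mul_left this (by linarith)
        nlinarith
      · rcases hu.2 n (by omega) with ⟨k, _⟩ | ⟨_, k⟩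
        · simp [g1] at k
        right
        rw [k, g3]
        have key : a + b - 2 ≤ t * (b ^ 2 - 1) := by
          have h1 : a * (a + b - 2) ≤ a * (t * (b ^ 2 - 1)) := by
            have : a * (t * (b ^ 2 - 1)) = (t * (a * (b - 1))) * (b + 1) := by ring
            rw [this, ht]
            nlinarith
          exact le_of_mul_le_mul_left h1 (by linarith)
        have h2 := mul_le_mul_of_nonneg_right ih' hb0.le
        nlinarith
    · rcases h.2 n (by omega) with ⟨g1, g2, g3⟩ | ⟨g1, g2, g3⟩
      · rcases hu.2 n (by omega) with ⟨_, k⟩ | ⟨k, _⟩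
        swap
        · simp [g1] at k
        right
        rw [k, g3]
        have h2 := mul_le_mul_of_nonneg_right ih hb0.le
        have : 0 ≤ a * x n := by positivity
        nlinarith
      · rcases hu.2 n (by omega) with ⟨k, _⟩ | ⟨_, k⟩
        · simp [g1] at k
        left
        rw [k]
        linarith

lemma finA2 {a b : ℝ} {x u : ℕ → ℝ} {e : ℕ → Bool} {l : ℕ} (h : WOrb a x e l)
    (hu : URec b x u e l) (ha : 1 < a) (ha3 : a ^ 2 ≤ 3) (hab : a ≤ b) (hb : b ≤ 2)
    (n₀ : ℕ) (h6 : n₀ ≤ 6) (hl : n₀ ≤ l)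
    (h0 : 1 ≤ (-u n₀ - 1/10) * (a * (b - 1))) :
    b ^ l ≤ 1000 * (|u l| + 1) := by
  have hb1 : 0 < b - 1 := by linarith
  have hp : 0 < a * (b - 1) := by positivity
  have hpow : b ^ n₀ ≤ 64 := by
    calc b ^ n₀ ≤ b ^ 6 := pow_le_pow_right₀ (by linarith) h6
      _ ≤ 2 ^ 6 := pow_le_pow_left₀ (by linarith) hb 6
      _ = 64 := by norm_num
  have ht : (1 / (a * (b - 1))) * (a * (b - 1)) = 1 := by field_simp
  have htpos : 0 < 1 / (a * (b - 1)) := by positivity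
  have h00 : 1 / (a * (b - 1)) ≤ -u n₀ - 1/10 := by rw [div_le_iff₀ hp]; exact h0
  set t := 1 / (a * (b - 1))
  obtain ⟨hx0, hx1⟩ := h.range ha (by linarith) l le_rfl
  have hbl : 0 < b ^ l := by have : 0 < b := by linarith
                             positivity
  rcases growA2 h hu ha ha3 hab hb t (1/640) ht n₀ (by linarith) l hl le_rfl with h1 | h1
  · have := neg_abs_le (u l)
    linarith
  · have h2 := le_abs_self (u l)
    have h3 : b * (1/640 * b ^ l) ≤ b * (|u l| + 1) := by nlinarith
    have h4 := le_of_mul_le_mul_left h3 (by linarith)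
    have := abs_nonneg (u l)
    linarith

lemma caseA {a b : ℝ} {x u : ℕ → ℝ} {e : ℕ → Bool} {l : ℕ} (h : WOrb a x e l)
    (hu : URec b x u e l) (ha : 1.41 ≤ a) (hab : a ≤ b) (hb : b ≤ 2) :
    b ^ l ≤ 1000 * (|u l| + 1) := by
  norm_num at ha
  have ha1 : 1 < a := by linarith
  by_cases hl : l < 6
  · have := abs_nonneg (u l)
    calc b ^ l ≤ b ^ 6 := pow_le_pow_right₀ (by linarith) (by omega)
      _ ≤ 2 ^ 6 := pow_le_pow_left₀ (by linarith) hb 6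
      _ ≤ 1000 * (|u l| + 1) := by linarith
  push Not at hl
  rcases le_total a 1.5 with h1 | h1
  · refine finA2 h hu ha1 (by nlinarith) hab hb 6 le_rfl hl ?_
    rw [first6 h hu (by norm_num; linarith) h1 hl]
    norm_num at h1
    have hm : 0.57 ≤ a * (b - 1) := by nlinarith
    suffices hs : 1.9 ≤ b * (b * (b * (b * (a + b - 2) - a * (2 - a)) + (2 - a * (a * (2 - a))))
       - (2 - a * (2 - a * (a * (2 - a))))) + (2 - a * (2 - a * (2 - a * (a * (2 - a))))) by
      rw [neg_neg]
      nlinarith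
    obtain ⟨r, hr⟩ : ∃ r, a = 1.41 + r := ⟨a - 1.41, by ring⟩
    have hr0 : 0 ≤ r := by norm_num at hr; linarith
    have k1 : a * (2 * a - 2) ≤ b * (a + b - 2) :=
      mul_le_mul hab (by linarith) (by linarith) (by linarith)
    have k2 : a * (a * (2 * a - 2) - a * (2 - a)) ≤ b * (b * (a + b - 2) - a * (2 - a)) :=
      mul_le_mul hab (by linarith) (by nlinarith) (by linarith)
    have k3 : a * (a * (a * (2 * a - 2) - a * (2 - a)) + (2 - a * (a * (2 - a)))) ≤
        b * (b * (b * (a + b - 2) - a * (2 - a)) + (2 - a * (a * (2 - a)))) :=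
      mul_le_mul hab (by linarith) (by
        rw [hr]; ring_nf; positivity) (by linarith)
    have k4 : a * (a * (a * (a * (2 * a - 2) - a * (2 - a)) + (2 - a * (a * (2 - a)))) -
        (2 - a * (2 - a * (a * (2 - a))))) ≤
        b * (b * (b * (b * (a + b - 2) - a * (2 - a)) + (2 - a * (a * (2 - a)))) -
        (2 - a * (2 - a * (a * (2 - a))))) :=
      mul_le_mul hab (by linarith) (by
        rw [hr]; ring_nf; positivity) (by linarith)
    have k5 : 0 ≤ a * (a * (a * (a * (2 * a - 2) - a * (2 - a)) + (2 - a * (a * (2 - a)))) -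
        (2 - a * (2 - a * (a * (2 - a))))) + (2 - a * (2 - a * (2 - a * (a * (2 - a))))) - 1.9 := by
      rw [hr]; ring_nf; positivity
    linarith
  rcases le_total a 1.6 with h2 | h2
  · refine finA2 h hu ha1 (by nlinarith) hab hb 4 (by norm_num) (by omega) ?_
    rw [(first4 h hu (by norm_num; linarith) h2 (by omega)).2]
    norm_num at h1 h2
    have hm : 0.75 ≤ a * (b - 1) := by nlinarith
    suffices hs : 1.5 ≤ b * (b * (a + b - 2) - a * (2 - a)) + (2 - a * (a * (2 - a))) by
      rw [neg_neg]
      nlinarith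
    have k1 : a * (2 * a - 2) ≤ b * (a + b - 2) :=
      mul_le_mul hab (by linarith) (by linarith) (by linarith)
    have k2 : a * (a * (2 * a - 2) - a * (2 - a)) ≤ b * (b * (a + b - 2) - a * (2 - a)) :=
      mul_le_mul hab (by linarith) (by nlinarith) (by linarith)
    obtain ⟨r, hr⟩ : ∃ r, a = 3/2 + r := ⟨a - 3/2, by ring⟩
    have hr0 : 0 ≤ r := by linarith
    have k5 : 0 ≤ a * (a * (2 * a - 2) - a * (2 - a)) + (2 - a * (a * (2 - a))) - 1.5 := by
      rw [hr]; ring_nf; positivity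
    linarith
  rcases le_total a 1.73 with h3 | h3
  · refine finA2 h hu ha1 (by nlinarith) hab hb 2 (by norm_num) (by omega) ?_
    rw [(first2 h hu ha1 (by omega)).2.2.2]
    norm_num at h1 h2
    have hm : 0.96 ≤ a * (b - 1) := by nlinarith
    nlinarith
  · norm_num at h3
    have h2 := (first2 h hu ha1 (by omega)).2.2.2
    have h4 : |u 2| = a + b - 2 := by rw [h2, abs_neg, abs_of_pos (by linarith)]
    have h5 := growA1 h hu ha1 hab hb (1/100) 2 (by rw [h4]; nlinarith) l (by omega) le_rfl
    have := abs_nonneg (u l)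
    nlinarith

lemma evenStep {a : ℝ} {x : ℕ → ℝ} {e : ℕ → Bool} {l : ℕ} (h : WOrb a x e l)
    (ha : 1 < a) (n : ℕ) (hn : n < l) (hx : 2 ≤ (1 + a) * x n) :
    e n = true ∧ x (n+1) = 2 - a * x n := by
  rcases h.2 n hn with ⟨_, h2, h3⟩ | ⟨h1, h2, h3⟩
  · nlinarith
  · exact ⟨h1, h3⟩

lemma evenRange {a : ℝ} {x : ℕ → ℝ} {e : ℕ → Bool} {l : ℕ} (h : WOrb a x e l)
    (ha : 1 < a) (ha2 : a ^ 2 ≤ 2) : ∀ i, 2 * i ≤ l → 2 ≤ (1 + a) * x (2 * i) ∧ x (2 * i) ≤ 1 := by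
  intro i
  induction i with
  | zero => intro _; simp only [mul_zero, h.1]; constructor <;> linarith
  | succ i ih =>
    intro hi
    refine ⟨?_, (h.range ha (by nlinarith) _ hi).2⟩
    obtain ⟨h1, h2⟩ := ih (by omega)
    obtain ⟨_, h3⟩ := evenStep h ha (2*i) (by omega) h1
    have e1 : 2 * (i + 1) = 2 * i + 1 + 1 := by ring
    rw [e1]
    rcases h.2 (2*i+1) (by omega) with ⟨_, k2, k3⟩ | ⟨_, k2, k3⟩
    · rw [k3, h3]
      have : (1 + a) * (a * (2 - a * 1)) ≤ (1 + a) * (a * (2 - a * x (2 * i))) := by gcongr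
      nlinarith [mul_nonneg (sub_nonneg.2 ha2) (sub_nonneg.2 ha.le)]
    · rw [k3, h3]
      nlinarith [mul_nonneg (sub_nonneg.2 h1) (sq_nonneg a)]

lemma renorm {a : ℝ} {x : ℕ → ℝ} {e : ℕ → Bool} {l : ℕ} (h : WOrb a x e l)
    (ha : 1 < a) (ha2 : a ^ 2 ≤ 2) :
    WOrb (a ^ 2) (fun i => ((1 + a) * x (2 * i) - 2) / (a - 1)) (fun i => !e (2 * i + 1)) (l / 2) := by
  have hp : 0 < a - 1 := by linarith
  refine ⟨?_, ?_⟩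
  · simp only [mul_zero, h.1]
    rw [div_eq_one_iff_eq hp.ne']; ring
  · intro i hi
    obtain ⟨h1, h2⟩ := evenRange h ha ha2 i (by omega)
    obtain ⟨_, h3⟩ := evenStep h ha (2*i) (by omega) h1
    have e1 : 2 * (i + 1) = 2 * i + 1 + 1 := by ring
    simp only [e1]
    rcases h.2 (2*i+1) (by omega) with ⟨k1, k2, k3⟩ | ⟨k1, k2, k3⟩
    · right
      rw [h3] at k2
      refine ⟨by simp [k1], ?_, ?_⟩
      · rw [← mul_div_assoc, le_div_iff₀ hp]
        nlinarith
      · rw [k3, h3]; field_simp; ring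
    · left
      rw [h3] at k2
      refine ⟨by simp [k1], ?_, ?_⟩
      · rw [← mul_div_assoc, div_le_iff₀ hp]
        nlinarith
      · rw [k3, h3]; field_simp; ring

lemma mixedEven {a b : ℝ} {x u : ℕ → ℝ} {e : ℕ → Bool} {l : ℕ} (h : WOrb a x e l)
    (hu : URec b x u e l) (ha : 1 < a) (ha2 : a ^ 2 ≤ 2) (hb : 2 ≤ b ^ 2) (hb2 : b ≤ 2)
    (hab : a ≤ b) : ∀ i, 2 ≤ i → 2 * i ≤ l →
      (a - 1) ^ 2 / 16 * b ^ (2 * i) ≤ |u (2 * i)| - (a + b - 2) := by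
  have step : ∀ i, 2 * (i + 1) ≤ l →
      |u (2 * (i + 1))| = |b ^ 2 * u (2 * i) + ((a + b) * x (2 * i) - 2)| := by
    intro i hi
    obtain ⟨h1, h2⟩ := evenRange h ha ha2 i (by omega)
    obtain ⟨h3, h4⟩ := step1 h hu (n := 2 * i) (by omega) (by nlinarith)
    have e1 : 2 * (i + 1) = 2 * i + 1 + 1 := by ring
    rw [e1]
    rcases hu.2 (2*i+1) (by omega) with ⟨_, k⟩ | ⟨_, k⟩
    · rw [k, h4, h3, ← abs_neg]; congr 1; ring
    · rw [k, h4, h3]; congr 1; ring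
  intro i hi
  induction i, hi using Nat.le_induction with
  | base =>
    intro hl
    obtain ⟨_, h2, _, h4⟩ := first2 h hu ha (by omega)
    have h5 := step 1 hl
    norm_num at h5 ⊢
    rw [h4, h2] at h5
    rw [h5]
    have h6 := neg_abs_le (b ^ 2 * (-(a + b - 2)) + ((a + b) * (a * (2 - a)) - 2))
    norm_num at h6 ⊢
    have h7 : b ^ 4 ≤ 16 := by
      calc b ^ 4 ≤ 2 ^ 4 := pow_le_pow_left₀ (by linarith) hb2 4
        _ = 16 := by norm_num
    have h8 : (a - 1) ^ 2 / 16 * b ^ 4 ≤ (a - 1) ^ 2 := by nlinarith [sq_nonneg (a - 1)]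
    have h9 : 2 * (a + b - 2) ≤ b ^ 2 * (a + b - 2) := by nlinarith
    have h10 : (a - 1) ^ 2 * 1 ≤ (a - 1) ^ 2 * (a + b) := by
      apply mul_le_mul_of_nonneg_left (by linarith) (sq_nonneg _)
    nlinarith
  | succ i hi ih =>
    intro hl
    have ih := ih (by omega)
    rw [step i hl]
    obtain ⟨h1, h2⟩ := evenRange h ha ha2 i (by omega)
    set g := (a + b) * x (2 * i) - 2
    have hg0 : 0 ≤ g := by
      have : 0 ≤ x (2 * i) := by nlinarith
      simp only [g]; nlinarith
    have hg1 : g ≤ a + b - 2 := by simp only [g]; nlinarith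
    have h3 : |b ^ 2 * u (2 * i)| ≤ |b ^ 2 * u (2 * i) + g| + |g| := by
      have := abs_sub (b ^ 2 * u (2 * i) + g) g
      simpa using this
    rw [abs_mul, abs_of_nonneg (sq_nonneg b), abs_of_nonneg hg0] at h3
    have e2 : b ^ (2 * (i + 1)) = b ^ (2 * i) * b ^ 2 := by ring
    rw [e2]
    have h4 := mul_le_mul_of_nonneg_right ih (sq_nonneg b)
    have h5 : 2 * (a + b - 2) ≤ b ^ 2 * (a + b - 2) := by nlinarith
    nlinarith

lemma orb_mono {a : ℝ} {x : ℕ → ℝ} {e : ℕ → Bool} {l m : ℕ} (h : WOrb a x e l) (hm : m ≤ l) :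
    WOrb a x e m := ⟨h.1, fun n hn => h.2 n (by omega)⟩

lemma exists_u {a b : ℝ} {x x' : ℕ → ℝ} {e : ℕ → Bool} {l : ℕ} (h : WOrb a x e l)
    (h' : WOrb b x' e l) (hab : a < b) :
    URec b x (fun n => (x' n - x n) / (b - a)) e l := by
  have hp : 0 < b - a := by linarith
  refine ⟨by simp [h.1, h'.1], ?_⟩
  intro n hn
  rcases h.2 n hn with ⟨k1, k2, k3⟩ | ⟨k1, k2, k3⟩ <;>
  rcases h'.2 n hn with ⟨m1, m2, m3⟩ | ⟨m1, m2, m3⟩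
  · left; refine ⟨k1, ?_⟩; simp only [k3, m3]; field_simp; ring
  · simp [k1] at m1
  · simp [k1] at m1
  · right; refine ⟨k1, ?_⟩; simp only [k3, m3]; field_simp; ring

/-- from growth of `u` to separation -/
lemma sep_of_u {a b : ℝ} {x x' : ℕ → ℝ} {e : ℕ → Bool} {l : ℕ} (h : WOrb a x e l)
    (h' : WOrb b x' e l) (ha : 1 < a) (hb : b ≤ 2) (hab : a < b) (C : ℝ) (hC : 0 ≤ C)
    (hg : b ^ l ≤ C * (|(x' l - x l) / (b - a)| + 1)) : (b - a) * b ^ l ≤ 2 * C := by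
  have hp : 0 < b - a := by linarith
  obtain ⟨h1, h2⟩ := h.range ha (by linarith) l le_rfl
  obtain ⟨h3, h4⟩ := h'.range (by linarith) hb l le_rfl
  have h5 : (b - a) * |(x' l - x l) / (b - a)| ≤ 1 := by
    rw [abs_div, abs_of_pos hp, mul_div_cancel₀ _ hp.ne', abs_le]
    constructor <;> linarith
  calc (b - a) * b ^ l ≤ (b - a) * (C * (|(x' l - x l) / (b - a)| + 1)) :=
        mul_le_mul_of_nonneg_left hg hp.le
    _ = C * ((b - a) * |(x' l - x l) / (b - a)| + (b - a)) := by ring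
    _ ≤ C * 2 := mul_le_mul_of_nonneg_left (by linarith) hC
    _ = 2 * C := by ring

def TentSep (β₀ : ℝ) : Prop := ∃ K : ℝ, 0 < K ∧ ∀ a b : ℝ, β₀ ≤ a → a ≤ b → b ≤ 2 →
  ∀ (l : ℕ) (x x' : ℕ → ℝ) (e : ℕ → Bool), WOrb a x e l → WOrb b x' e l → (b - a) * b ^ l ≤ K

lemma mixed {a b β₀ : ℝ} {x x' : ℕ → ℝ} {e : ℕ → Bool} {l : ℕ} (h : WOrb a x e l)
    (h' : WOrb b x' e l) (hβ : 1 < β₀) (ha : β₀ ≤ a) (ha2 : a ^ 2 ≤ 2) (hb : 2 ≤ b ^ 2)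
    (hb2 : b ≤ 2) (hab : a < b) : (b - a) * b ^ l ≤ 64 / (β₀ - 1) ^ 2 + 100 := by
  have hq : 0 < (β₀ - 1) ^ 2 := by have : 0 < β₀ - 1 := by linarith
                                   positivity
  have hK : 0 < 64 / (β₀ - 1) ^ 2 := by positivity
  by_cases hl : l < 4
  · have : b ^ l ≤ 16 := by
      calc b ^ l ≤ b ^ 4 := pow_le_pow_right₀ (by linarith) (by omega)
        _ ≤ 2 ^ 4 := pow_le_pow_left₀ (by linarith) hb2 4
        _ = 16 := by norm_num
    nlinarith
  push Not at hl
  have h1 := orb_mono h (m := 2 * (l / 2)) (by omega)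
  have h1' := orb_mono h' (m := 2 * (l / 2)) (by omega)
  have hu := exists_u h1 h1' hab
  have h2 := mixedEven h1 hu (by linarith) ha2 hb hb2 hab.le (l / 2) (by omega) le_rfl
  have h3 := sep_of_u h1 h1' (by linarith) hb2 hab (16 / (β₀ - 1) ^ 2) (by positivity) (by
    rw [div_mul_eq_mul_div, le_div_iff₀ hq]
    have h4 : (β₀ - 1) ^ 2 ≤ (a - 1) ^ 2 := pow_le_pow_left₀ (by linarith) (by linarith) 2
    have h5 : 0 < b ^ (2 * (l / 2)) := by have : 0 < b := by linarith
                                          positivity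
    have h6 := mul_le_mul_of_nonneg_left h4 h5.le
    linarith)
  have h4 : b ^ l ≤ 2 * b ^ (2 * (l / 2)) := by
    have h5 : 0 < b ^ (2 * (l / 2)) := by have : 0 < b := by linarith
                                          positivity
    calc b ^ l ≤ b ^ (2 * (l / 2) + 1) := pow_le_pow_right₀ (by linarith) (by omega)
      _ = b * b ^ (2 * (l / 2)) := by ring
      _ ≤ _ := by gcongr
  calc (b - a) * b ^ l ≤ (b - a) * (2 * b ^ (2 * (l / 2))) :=
        mul_le_mul_of_nonneg_left h4 (by linarith)
    _ = 2 * ((b - a) * b ^ (2 * (l / 2))) := by ring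
    _ ≤ 2 * (2 * (16 / (β₀ - 1) ^ 2)) := by linarith
    _ = 64 / (β₀ - 1) ^ 2 := by ring
    _ ≤ _ := by linarith

lemma sep_all (m : ℕ) : ∀ β₀ : ℝ, 1 < β₀ → 2 ≤ β₀ ^ (2 ^ m) → TentSep β₀ := by
  induction m with
  | zero =>
    intro β₀ _ h
    refine ⟨1, one_pos, ?_⟩
    intro a b h1 h2 h3 l x x' e _ _
    have h0 : b - a = 0 := by norm_num at h; linarith
    rw [h0]; norm_num
  | succ m ih =>
    intro β₀ hβ h
    obtain ⟨K', hK', hS⟩ := ih (β₀ ^ 2) (by nlinarith) (by rw [← pow_mul]; rw [pow_succ, mul_comm] at h; exact h)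
    have hq : 0 < (β₀ - 1) ^ 2 := by have : 0 < β₀ - 1 := by linarith
                                     positivity
    have hK : 0 < 64 / (β₀ - 1) ^ 2 := by positivity
    refine ⟨K' + 64 / (β₀ - 1) ^ 2 + 100 + 2000, by linarith, ?_⟩
    intro a b h1 h2 h3 l x x' e ho ho'
    rcases h2.eq_or_lt with heq | hlt
    · rw [heq]; simp; linarith
    by_cases ha : 2 ≤ a ^ 2
    · have := sep_of_u ho ho' (by linarith) h3 hlt 1000 (by norm_num)
        (caseA ho (exists_u ho ho' hlt) (by norm_num; nlinarith) h2 h3)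
      linarith
    push Not at ha
    by_cases hb : 2 ≤ b ^ 2
    · have := mixed ho ho' hβ h1 ha.le hb h3 hlt
      linarith
    push Not at hb
    have h4 := renorm ho (by linarith) ha.le
    have h5 := renorm ho' (by linarith) hb.le
    have h6 := hS (a ^ 2) (b ^ 2) (pow_le_pow_left₀ (by linarith) h1 2)
      (pow_le_pow_left₀ (by linarith) h2 2) hb.le (l / 2) _ _ _ h4 h5
    have hb0 : 0 < b := by linarith
    have h7 : (b - a) * b ^ l ≤ (b ^ 2 - a ^ 2) * (b ^ 2) ^ (l / 2) := by
      have hp : 0 < (b ^ 2) ^ (l / 2) := by positivity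
      calc (b - a) * b ^ l ≤ (b - a) * b ^ (2 * (l / 2) + 1) :=
            mul_le_mul_of_nonneg_left (pow_le_pow_right₀ (by linarith) (by omega)) (by linarith)
        _ = ((b - a) * b) * (b ^ 2) ^ (l / 2) := by rw [pow_succ, pow_mul]; ring
        _ ≤ (b ^ 2 - a ^ 2) * (b ^ 2) ^ (l / 2) :=
            mul_le_mul_of_nonneg_right (by nlinarith) hp.le
    linarith

lemma sep_main (β₀ : ℝ) (hβ : 1 < β₀) : TentSep β₀ := by
  obtain ⟨n, hn⟩ := pow_unbounded_of_one_lt 2 hβ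
  refine sep_all n β₀ hβ (hn.le.trans ?_)
  exact pow_le_pow_right₀ hβ.le Nat.lt_two_pow_self.le

lemma lap_cases {β x : ℝ} (hx : 0 ≤ β * x) :
    (lapIdx 2 β x = 0 ∧ β * x ≤ 1) ∨ (lapIdx 2 β x = 1 ∧ 1 ≤ β * x) := by
  unfold lapIdx
  rcases lt_or_ge (β * x) 1 with h | h
  · left
    have : ⌊β * x⌋ = 0 := by rw [Int.floor_eq_zero_iff]; exact ⟨hx, h⟩
    rw [this]; exact ⟨by simp, h.le⟩
  · right
    have : 1 ≤ ⌊β * x⌋ := by rw [Int.le_floor]; exact_mod_cast h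
    refine ⟨?_, h⟩
    omega

lemma orbit_range {s : ℕ → ℤ} (hs : (s 0 = 1 ∧ s 1 = -1) ∨ (s 0 = -1 ∧ s 1 = 1)) {β : ℝ}
    (h1 : 1 < β) (h2 : β ≤ 2) (n : ℕ) :
    0 ≤ (genBetaMap 2 s β)^[n] 1 ∧ (genBetaMap 2 s β)^[n] 1 ≤ 1 := by
  induction n with
  | zero => simp
  | succ n ih =>
    rw [Function.iterate_succ_apply']
    set y := (genBetaMap 2 s β)^[n] 1
    obtain ⟨hy0, hy1⟩ := ih
    have hb : β * y ≤ 2 := by nlinarith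
    have hb0 : 0 ≤ β * y := by positivity
    unfold genBetaMap
    rcases lap_cases hb0 with ⟨k1, k2⟩ | ⟨k1, k2⟩ <;> rcases hs with ⟨s0, s1⟩ | ⟨s0, s1⟩ <;>
      rw [k1] <;> simp only [s0, s1] <;> norm_num <;> constructor <;> linarith

lemma orb_tent {s : ℕ → ℤ} (hs : s 0 = 1 ∧ s 1 = -1) {β : ℝ}
    (h1 : 1 < β) (h2 : β ≤ 2) (l : ℕ) :
    WOrb β (fun n => (genBetaMap 2 s β)^[n] 1) (fun n => decide (genDigit 2 s β n = 1)) l := by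
  refine ⟨by simp, ?_⟩
  intro n _
  have hy0 := (orbit_range (Or.inl hs) h1 h2 n).1
  simp only [Function.iterate_succ_apply']
  have hg : genDigit 2 s β n = lapIdx 2 β ((genBetaMap 2 s β)^[n] 1) := rfl
  generalize (genBetaMap 2 s β)^[n] 1 = y at hy0 hg ⊢
  obtain ⟨s0, s1⟩ := hs
  rcases lap_cases (β := β) (x := y) (by positivity) with ⟨k1, k2⟩ | ⟨k1, k2⟩
  · left
    refine ⟨by simp [hg, k1], k2, ?_⟩
    unfold genBetaMap; rw [k1]; simp [s0]
  · right
    refine ⟨by simp [hg, k1], k2, ?_⟩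
    unfold genBetaMap; rw [k1]; simp [s1]; ring

lemma orb_vee {s : ℕ → ℤ} (hs : s 0 = -1 ∧ s 1 = 1) {β : ℝ}
    (h1 : 1 < β) (h2 : β ≤ 2) (l : ℕ) :
    WOrb β (fun n => Nat.casesOn n 1 (fun m => 1 - (β - 1) * (genBetaMap 2 s β)^[m] 1))
      (fun n => Nat.casesOn n true (fun m => decide (genDigit 2 s β m = 0))) l := by
  refine ⟨by simp, ?_⟩
  intro n _
  cases n with
  | zero =>
    right
    refine ⟨rfl, ?_, ?_⟩
    · simp; linarith
    · simp; ring
  | succ n =>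
    have hy0 := (orbit_range (Or.inr hs) h1 h2 n).1
    simp only [Function.iterate_succ_apply']
    have hg : genDigit 2 s β n = lapIdx 2 β ((genBetaMap 2 s β)^[n] 1) := rfl
    generalize (genBetaMap 2 s β)^[n] 1 = y at hy0 hg ⊢
    obtain ⟨s0, s1⟩ := hs
    rcases lap_cases (β := β) (x := y) (by positivity) with ⟨k1, k2⟩ | ⟨k1, k2⟩
    · right
      refine ⟨by simp [hg, k1], by nlinarith, ?_⟩
      unfold genBetaMap; rw [k1]; simp [s0]; ring
    · left
      refine ⟨by simp [hg, k1], by nlinarith, ?_⟩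
      unfold genBetaMap; rw [k1]; simp [s1]; ring

lemma orb_congr {a : ℝ} {x : ℕ → ℝ} {e e' : ℕ → Bool} {l : ℕ} (h : WOrb a x e l)
    (he : ∀ n < l, e n = e' n) : WOrb a x e' l :=
  ⟨h.1, fun n hn => by rw [← he n hn]; exact h.2 n hn⟩

/-- Exponential separation of critical orbits for the tent-map family `s = (+1,-1)`
(or `s = (-1,+1)`): for every `β₀ > 1` there is `K > 0` such that if `β₀ ≤ β₁ ≤ β₂ ≤ 2` and the
digit sequences of `1` agree up to index `l`, then `β₂ - β₁ ≤ K·β₂^{-l}`. -/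
theorem genBeta_separation_tent (s : ℕ → ℤ)
    (hs : (s 0 = 1 ∧ s 1 = -1) ∨ (s 0 = -1 ∧ s 1 = 1)) (β₀ : ℝ) (hβ₀ : 1 < β₀) :
    ∃ K : ℝ, 0 < K ∧ ∀ β₁ β₂ : ℝ, β₀ ≤ β₁ → β₁ ≤ β₂ → β₂ ≤ 2 →
      ∀ l : ℕ, (∀ n < l, genDigit 2 s β₁ n = genDigit 2 s β₂ n) →
        β₂ - β₁ ≤ K * β₂ ^ (-(l : ℤ)) := by
  obtain ⟨K, hK, hS⟩ := sep_main β₀ hβ₀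
  refine ⟨K, hK, ?_⟩
  intro β₁ β₂ h1 h2 h3 l hd
  have hb : 0 < β₂ := by linarith
  rw [zpow_neg, zpow_natCast, ← div_eq_mul_inv, le_div_iff₀ (by positivity)]
  rcases hs with hs | hs
  · have o1 := orb_tent hs (β := β₁) (by linarith) (by linarith) l
    have o2 := orb_tent hs (β := β₂) (by linarith) (by linarith) l
    exact hS β₁ β₂ h1 h2 h3 l _ _ _ (orb_congr o1 (fun n hn => by simp only [hd n hn])) o2
  · have o1 := orb_vee hs (β := β₁) (by linarith) (by linarith) (l + 1)
    have o2 := orb_vee hs (β := β₂) (by linarith) (by linarith) (l + 1)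
    have h4 := hS β₁ β₂ h1 h2 h3 (l + 1) _ _ _ (orb_congr o1 (fun n hn => by
      cases n with
      | zero => rfl
      | succ n => simp only [hd n (by omega)])) o2
    refine le_trans ?_ h4
    apply mul_le_mul_of_nonneg_left _ (by linarith)
    exact pow_le_pow_right₀ (by linarith) (by omega)
end

section
/- Let k = 2 with sign sequence s = (−1,−1), and consider the generalized β-maps T_β for β ∈ (1,2]. There exist β₀ ∈ (1,2) and K > 0 such that for all β₁, β₂ with β₀ ≤ β₁ ≤ β₂ ≤ 2 and every l ∈ ℕ: if the digit sequences of 1 agree up to index l, i.e., d_n(β₁) = d_n(β₂) for all n < l, then β₂ − β₁ ≤ K·β₂^{-l}. -/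
theorem lap_aux (β x : ℝ) (h0 : 0 ≤ β * x) (h2 : β * x ≤ 2) :
    (lapIdx 2 β x = 0 ∨ lapIdx 2 β x = 1) ∧ 0 ≤ β * x - (lapIdx 2 β x : ℝ) ∧
      β * x - (lapIdx 2 β x : ℝ) ≤ 1 := by
  by_cases h : β * x < 1
  · have hf : ⌊β * x⌋ = 0 := by
      rw [Int.floor_eq_iff]; push_cast; constructor <;> linarith
    have : lapIdx 2 β x = 0 := by simp [lapIdx, hf]
    rw [this]; push_cast
    exact ⟨by simp, by linarith, by linarith⟩
  · have hf : 1 ≤ ⌊β * x⌋ := by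
      rw [Int.le_floor]; push_cast; linarith
    have : lapIdx 2 β x = 1 := by
      unfold lapIdx; omega
    rw [this]; push_cast
    exact ⟨by simp, by linarith, by linarith⟩

theorem map_aux (s : ℕ → ℤ) (hs : s 0 = -1 ∧ s 1 = -1) (β x : ℝ) (h0 : 0 ≤ β * x)
    (h2 : β * x ≤ 2) : genBetaMap 2 s β x = 1 - (β * x - (lapIdx 2 β x : ℝ)) := by
  unfold genBetaMap
  rw [if_neg]
  rcases (lap_aux β x h0 h2).1 with h | h <;> rw [h]
  · rw [hs.1]; decide
  · rw [hs.2]; decide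

theorem orbit_aux (s : ℕ → ℤ) (hs : s 0 = -1 ∧ s 1 = -1) (β : ℝ) (h1 : 0 ≤ β) (h2 : β ≤ 2)
    (n : ℕ) : 0 ≤ (genBetaMap 2 s β)^[n] 1 ∧ (genBetaMap 2 s β)^[n] 1 ≤ 1 := by
  induction n with
  | zero => simp
  | succ n ih =>
    rw [Function.iterate_succ_apply']
    obtain ⟨a, b⟩ := ih
    have c : 0 ≤ β * (genBetaMap 2 s β)^[n] 1 := mul_nonneg h1 a
    have d : β * (genBetaMap 2 s β)^[n] 1 ≤ 2 := by nlinarith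
    rw [map_aux s hs _ _ c d]
    have := lap_aux _ _ c d
    constructor <;> linarith [this.2.1, this.2.2]

theorem step_aux (s : ℕ → ℤ) (hs : s 0 = -1 ∧ s 1 = -1) (β : ℝ) (h1 : 0 ≤ β) (h2 : β ≤ 2)
    (n : ℕ) : (genBetaMap 2 s β)^[n+1] 1 =
      1 - (β * (genBetaMap 2 s β)^[n] 1 - (genDigit 2 s β n : ℝ)) := by
  obtain ⟨a, b⟩ := orbit_aux s hs β h1 h2 n
  rw [Function.iterate_succ_apply', map_aux s hs _ _ (mul_nonneg h1 a) (by nlinarith)]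
  rfl

/-- Exponential separation of critical orbits for the family `s = (-1,-1)`: there exist
`β₀ ∈ (1,2)` and `K > 0` such that if `β₀ ≤ β₁ ≤ β₂ ≤ 2` and the digit sequences of `1` agree
up to index `l`, then `β₂ - β₁ ≤ K·β₂^{-l}`. -/
theorem genBeta_separation_minus_minus (s : ℕ → ℤ) (hs : s 0 = -1 ∧ s 1 = -1) :
    ∃ β₀ : ℝ, 1 < β₀ ∧ β₀ < 2 ∧ ∃ K : ℝ, 0 < K ∧
      ∀ β₁ β₂ : ℝ, β₀ ≤ β₁ → β₁ ≤ β₂ → β₂ ≤ 2 →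
        ∀ l : ℕ, (∀ n < l, genDigit 2 s β₁ n = genDigit 2 s β₂ n) →
          β₂ - β₁ ≤ K * β₂ ^ (-(l : ℤ)) := by
  refine ⟨1.9, by norm_num, by norm_num, 10, by norm_num, ?_⟩
  intro β₁ β₂ h1 h12 h2 l hl
  have p1 : (0:ℝ) ≤ β₁ := by linarith
  have p2 : (0:ℝ) < β₂ := by linarith
  have hδ : 0 ≤ β₂ - β₁ := by linarith
  suffices H : (β₂ - β₁) * β₂ ^ l ≤ 10 by
    rw [zpow_neg, zpow_natCast, ← div_eq_mul_inv, le_div_iff₀ (pow_pos p2 l)]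
    exact H
  have S1 := step_aux s hs β₁ p1 (h12.trans h2)
  have S2 := step_aux s hs β₂ p2.le h2
  have O1 := orbit_aux s hs β₁ p1 (h12.trans h2)
  have O2 := orbit_aux s hs β₂ p2.le h2
  have Z1 : (genBetaMap 2 s β₁)^[0] 1 = 1 := rfl
  have Z2 : (genBetaMap 2 s β₂)^[0] 1 = 1 := rfl
  set x : ℕ → ℝ := fun n => (genBetaMap 2 s β₁)^[n] 1 with hx
  set y : ℕ → ℝ := fun n => (genBetaMap 2 s β₂)^[n] 1 with hy
  have R : ∀ n < l, y (n+1) - x (n+1) = -(β₂ * (y n - x n) + (β₂ - β₁) * x n) := by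
    intro n hn
    simp only [hx, hy]
    rw [S1, S2, hl n hn]; ring
  have Ox : ∀ n, 0 ≤ x n ∧ x n ≤ 1 := O1
  have Oy : ∀ n, 0 ≤ y n ∧ y n ≤ 1 := O2
  have x0 : x 0 = 1 := Z1
  have y0 : y 0 = 1 := Z2
  rcases Nat.lt_or_ge l 2 with h | h
  · interval_cases l
    · simp; linarith
    · simp; nlinarith
  have key : ∀ n, 2 ≤ n → n ≤ l →
      (β₂ - β₁) * (1.2 + 0.1 * β₂ ^ n) ≤ |y n - x n| := by
    intro n hn
    induction n, hn using Nat.le_induction with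
    | base =>
      intro _
      have r0 := R 0 (by omega)
      have r1 := R 1 (by omega)
      norm_num at r0 r1
      rw [x0, y0] at r0
      have x1 : x 1 ≤ 0.1 := by
        have e : x 1 = 1 - (β₁ * 1 - (genDigit 2 s β₁ 0 : ℝ)) := by
          have := S1 0
          rw [Z1] at this
          exact this
        have := (lap_aux β₁ 1 (by linarith) (by linarith)).1
        have g : (genDigit 2 s β₁ 0 : ℝ) ≤ 1 := by
          have : genDigit 2 s β₁ 0 ≤ 1 := by
            show lapIdx 2 β₁ 1 ≤ 1
            omega
          exact_mod_cast this
        linarith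
      have e : y 2 - x 2 = (β₂ - β₁) * (β₂ - x 1) := by
        have r0' : y 1 - x 1 = -(β₂ - β₁) := by linarith
        rw [r0'] at r1
        linarith
      rw [e]
      refine le_trans ?_ (le_abs_self _)
      apply mul_le_mul_of_nonneg_left _ hδ
      nlinarith
    | succ n hn ih =>
      intro hnl
      have ih := ih (by omega)
      rw [R n (by omega), abs_neg]
      have t := abs_sub_abs_le_abs_sub (β₂ * (y n - x n)) (-((β₂ - β₁) * x n))
      rw [sub_neg_eq_add, abs_neg, abs_mul, abs_of_pos p2,
        abs_of_nonneg (mul_nonneg hδ (Ox n).1)] at t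
      have u : (β₂ - β₁) * x n ≤ (β₂ - β₁) := mul_le_of_le_one_right hδ (Ox n).2
      have v := mul_le_mul_of_nonneg_left ih p2.le
      rw [pow_succ]
      nlinarith
  have := key l h le_rfl
  have b : |y l - x l| ≤ 1 := by
    rw [abs_le]
    constructor <;> linarith [(Ox l).1, (Ox l).2, (Oy l).1, (Oy l).2]
  nlinarith
end
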